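/- There is an absolute constant C > 0 with the following property. Let n, d, k ≥ 1 be integers and ε > 0 with k ≤ εn/4, and let 𝔽 be a finite field with d ≤ |𝔽|^k. If S ⊆ 𝔽^n is a uniformly random subset of size |S| = |𝔽|^{(1−ε)n}, then with probability tending to 1 (in particular, with probability at least 1/2), for every affine variety V ⊆ 𝔽̄^n of degree d and dimension k that is defined over 𝔽 one has |S ∩ V| ≤ C·(d/ε)·binom(k+d+2, k). -/

import Mathlib

open MvPolynomial

/-- The zero locus of a set of multivariate polynomials. -/
def zeroLocus (K : Type*) [Field K] (n : ℕ) (S : Set (MvPolynomial (Fin n) K)) :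
    Set (Fin n → K) := {x | ∀ f ∈ S, eval x f = 0}

/-- An affine variety is the common zero set of finitely many polynomials. -/
def IsAffineVariety (K : Type*) [Field K] (n : ℕ) (V : Set (Fin n → K)) : Prop :=
  ∃ s : Finset (MvPolynomial (Fin n) K), V = zeroLocus K n ↑s

/-- The Zariski topology on affine n-space. -/
instance zariskiTopology (K : Type*) [Field K] (n : ℕ) : TopologicalSpace (Fin n → K) :=
  TopologicalSpace.generateFrom
    {U | ∃ S : Set (MvPolynomial (Fin n) K), U = (zeroLocus K n S)ᶜ}

/-- Dimension of a subset of affine space: Krull dimension in the Zariski topology. -/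
noncomputable def vdim (K : Type*) [Field K] (n : ℕ) (V : Set (Fin n → K)) : WithBot ℕ∞ :=
  topologicalKrullDim ↥V

/-- An affine-linear subspace: zero set of polynomials of degree at most one. -/
def IsAffineSubspace (K : Type*) [Field K] (n : ℕ) (L : Set (Fin n → K)) : Prop :=
  ∃ S : Set (MvPolynomial (Fin n) K), (∀ f ∈ S, totalDegree f ≤ 1) ∧ L = zeroLocus K n S

/-- Degree of an irreducible variety: number of intersection points with a generic
(affine-linear) subspace of complementary dimension. -/
noncomputable def irrDegree (K : Type*) [Field K] (n : ℕ) (W : Set (Fin n → K)) : ℕ∞ :=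
  ⨆ (L : Set (Fin n → K)) (_ : IsAffineSubspace K n L)
    (_ : vdim K n W + vdim K n L = (n : WithBot ℕ∞)) (_ : (W ∩ L).Finite),
    ((W ∩ L).ncard : ℕ∞)

/-- Degree of a variety: sum of degrees of its irreducible components. -/
noncomputable def vdeg (K : Type*) [Field K] (n : ℕ) (V : Set (Fin n → K)) : ℕ∞ :=
  ∑' W : irreducibleComponents ↥V, irrDegree K n (Subtype.val '' (W.1 : Set ↥V))

/-- The ideal of polynomials vanishing on a set. -/
noncomputable def vanishingIdeal (K : Type*) [Field K] (n : ℕ) (V : Set (Fin n → K)) :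
    Ideal (MvPolynomial (Fin n) K) where
  carrier := {f | ∀ x ∈ V, eval x f = 0}
  add_mem' {f g} hf hg := fun x hx => by simp [hf x hx, hg x hx]
  zero_mem' := fun x hx => by simp
  smul_mem' := fun c f hf x hx => by simp [hf x hx]

/-- A variety is defined over a subfield `F` if its vanishing ideal is generated by
finitely many polynomials with coefficients in `F`. -/
def DefinedOver (F K : Type*) [Field F] [Field K] [Algebra F K] (n : ℕ)
    (V : Set (Fin n → K)) : Prop :=
  ∃ s : Finset (MvPolynomial (Fin n) F),
    vanishingIdeal K n V = Ideal.span ((MvPolynomial.map (algebraMap F K)) '' ↑s)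


namespace RSV

/-- The Rees-like subalgebra generated by `T` and `T y_i`. -/
noncomputable def rees (K : Type*) {L ι : Type*} [Field K] [Field L] [Algebra K L] (y : ι → L) :
    Subalgebra K (Polynomial L) :=
  Algebra.adjoin K ({Polynomial.X} ∪ Set.range (fun i => Polynomial.X * Polynomial.C (y i)))

section step
variable {K L : Type*} [Field K] [Field L] [Algebra K L]

/-- A polynomial in one variable with unit coefficient in the top degree gives integrality. -/
theorem isIntegral_of_coeff {S M : Type*} [CommRing S] [CommRing M] [Algebra S M] (z : M)
    (f : Polynomial S) (g : ℕ) (hd : f.natDegree ≤ g) (u : S) (hu : u * f.coeff g = 1)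
    (h0 : Polynomial.aeval z f = 0) : IsIntegral S z := by
  refine ⟨Polynomial.C u * f, ?_, ?_⟩
  · exact Polynomial.monic_of_natDegree_le_of_coeff_eq_one g
      ((Polynomial.natDegree_C_mul_le _ _).trans hd) (by simpa using hu)
  · rw [← Polynomial.aeval_def, map_mul, h0, mul_zero]

theorem prod_lin {S ι : Type*} [CommRing S] (s : Finset ι) (a c : ι → S) (α : ι → ℕ) :
    (∏ j ∈ s, (Polynomial.C (a j) + Polynomial.C (c j) * Polynomial.X) ^ α j).natDegree
        ≤ ∑ j ∈ s, α j ∧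
    (∏ j ∈ s, (Polynomial.C (a j) + Polynomial.C (c j) * Polynomial.X) ^ α j).coeff
        (∑ j ∈ s, α j) = ∏ j ∈ s, c j ^ α j := by
  classical
  have h1 : ∀ j, (Polynomial.C (a j) + Polynomial.C (c j) * Polynomial.X).natDegree ≤ 1 := by
    intro j; compute_degree
  have h2 : ∀ j, ((Polynomial.C (a j) + Polynomial.C (c j) * Polynomial.X) ^ α j).natDegree
      ≤ α j := by
    intro j
    refine Polynomial.natDegree_pow_le.trans ?_
    nlinarith [h1 j]
  induction s using Finset.induction_on with
  | empty => simp
  | insert j s hj ih =>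
    rw [Finset.prod_insert hj, Finset.sum_insert hj, Finset.prod_insert hj]
    refine ⟨Polynomial.natDegree_mul_le.trans (add_le_add (h2 j) ih.1), ?_⟩
    rw [Polynomial.coeff_mul_add_eq_of_natDegree_le (h2 j) ih.1, ih.2]
    congr 1
    have := Polynomial.coeff_pow_of_natDegree_le (m := α j) (h1 j)
    rw [mul_one] at this
    rw [this]
    simp

theorem integral_step {σ : Type*} [Fintype σ] (G : MvPolynomial σ K) (g : ℕ)
    (hg : G.totalDegree ≤ g) (c : σ → K) (hc : eval c (homogeneousComponent g G) ≠ 0)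
    (y' : σ → L) (Z : L) (h0 : aeval (fun j => y' j + c j • Z) G = 0)
    (S : Subalgebra K (Polynomial L)) (hX : Polynomial.X ∈ S)
    (hy : ∀ j, Polynomial.X * Polynomial.C (y' j) ∈ S) :
    IsIntegral S (Polynomial.X * Polynomial.C Z) := by
  classical
  let Xs : S := ⟨Polynomial.X, hX⟩
  let ys : σ → S := fun j => ⟨_, hy j⟩
  let Φ : Polynomial S := ∑ α ∈ G.support, Polynomial.C (algebraMap K S (coeff α G) *
    Xs ^ (g - α.degree)) * ∏ j, (Polynomial.C (ys j) +
      Polynomial.C (algebraMap K S (c j)) * Polynomial.X) ^ α j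
  have hdeg : ∀ α : σ →₀ ℕ, α.degree = ∑ j, α j := fun α => by
    rw [Finsupp.degree_eq_sum]
  have hle : ∀ α ∈ G.support, α.degree ≤ g := fun α hα => by
    refine le_trans ?_ hg
    have := le_totalDegree hα
    rwa [Finsupp.sum_fintype _ _ (fun _ => rfl), ← hdeg] at this
  refine isIntegral_of_coeff _ Φ g ?_ (algebraMap K S (eval c (homogeneousComponent g G))⁻¹) ?_ ?_
  · refine Polynomial.natDegree_sum_le_of_forall_le _ _ fun α hα => ?_
    refine (Polynomial.natDegree_C_mul_le _ _).trans ?_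
    refine (prod_lin Finset.univ ys (fun j => algebraMap K S (c j)) α).1.trans ?_
    rw [← hdeg]; exact hle α hα
  · have : Φ.coeff g = algebraMap K S (eval c (homogeneousComponent g G)) := by
      simp only [Φ, Polynomial.finsetSum_coeff, Polynomial.coeff_C_mul]
      rw [homogeneousComponent_apply, map_sum, map_sum, Finset.sum_filter]
      refine Finset.sum_congr rfl fun α hα => ?_
      obtain ⟨h1, h2⟩ := prod_lin Finset.univ ys (fun j => algebraMap K S (c j)) α
      split_ifs with h
      · rw [← hdeg, h] at h2
        rw [h2, h, eval_monomial, Finsupp.prod_fintype _ _ (fun _ => pow_zero _)]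
        simp
      · rw [Polynomial.coeff_eq_zero_of_natDegree_lt, mul_zero]
        refine h1.trans_lt ?_
        rw [← hdeg]
        exact lt_of_le_of_ne (hle α hα) h
    rw [this, ← map_mul, inv_mul_cancel₀ hc, map_one]
  · have key : Polynomial.aeval (Polynomial.X * Polynomial.C Z) Φ =
        Polynomial.X ^ g * Polynomial.C (aeval (fun j => y' j + c j • Z) G) := by
      simp only [Φ, map_sum, map_mul, map_prod, map_pow, map_add, Polynomial.aeval_C,
        Polynomial.aeval_X]
      conv_rhs => rw [G.as_sum]
      simp only [map_sum, aeval_monomial, Finset.mul_sum]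
      refine Finset.sum_congr rfl fun α hα => ?_
      have e1 : ∀ j, algebraMap S (Polynomial L) (ys j) + algebraMap S (Polynomial L)
          (algebraMap K S (c j)) * (Polynomial.X * Polynomial.C Z) =
          Polynomial.X * Polynomial.C (y' j + c j • Z) := by
        intro j
        have : algebraMap S (Polynomial L) (algebraMap K S (c j)) =
          Polynomial.C (algebraMap K L (c j)) := rfl
        rw [this, Algebra.smul_def, map_add, map_mul]
        change Polynomial.X * Polynomial.C (y' j) + _ = _
        ring
      simp only [e1]
      simp only [mul_pow, Finset.prod_mul_distrib, Finset.prod_pow_eq_pow_sum]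
      rw [Finsupp.prod_fintype _ _ (fun _ => pow_zero _), ← hdeg]
      have e2 : algebraMap S (Polynomial L) (algebraMap K S (coeff α G)) =
          Polynomial.C (algebraMap K L (coeff α G)) := rfl
      have e3 : algebraMap S (Polynomial L) Xs = Polynomial.X := rfl
      rw [e2, e3, map_mul, map_prod]
      simp only [map_pow]
      obtain ⟨b, hb⟩ := Nat.exists_eq_add_of_le (hle α hα)
      rw [hb, Nat.add_sub_cancel_left, pow_add]
      ring
    rw [key, h0, map_zero, mul_zero]

theorem deriv_chain {k σ : Type*} [Field k] [Algebra K k] [Fintype σ] (a c : σ → k)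
    (G : MvPolynomial σ K) :
    Polynomial.derivative (aeval (fun j => Polynomial.C (a j) + Polynomial.C (c j) * Polynomial.X) G)
      = ∑ j, Polynomial.C (c j) *
        aeval (fun j => Polynomial.C (a j) + Polynomial.C (c j) * Polynomial.X) (pderiv j G) := by
  classical
  induction G using MvPolynomial.induction_on with
  | C b => 
    simp [IsScalarTower.algebraMap_apply K k (Polynomial k)]
  | add p q hp hq => simp [hp, hq, mul_add, Finset.sum_add_distrib]
  | mul_X p i hp =>
    have e : ∀ j, pderiv j (p * X i) = pderiv j p * X i + p * C (if j = i then 1 else 0) := by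
      intro j
      rw [Derivation.leibniz, pderiv_X, Pi.single_apply, smul_eq_mul, smul_eq_mul]
      by_cases h : j = i
      · subst h; simp; ring
      · rw [if_neg (fun h' => h h'.symm), if_neg h]; simp; ring
    have e2 : Polynomial.derivative (Polynomial.C (a i) + Polynomial.C (c i) * Polynomial.X) =
      Polynomial.C (c i) := by simp
    rw [map_mul, Polynomial.derivative_mul, hp, aeval_X, e2]
    simp only [e, map_mul, aeval_X, map_add (aeval _)]
    have e3 : ∀ j, Polynomial.C (c j) * (aeval (fun j => Polynomial.C (a j) + Polynomial.C (c j) *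
        Polynomial.X) (pderiv j p) * (Polynomial.C (a i) + Polynomial.C (c i) * Polynomial.X) +
        aeval (fun j => Polynomial.C (a j) + Polynomial.C (c j) * Polynomial.X) p *
        aeval (fun j => Polynomial.C (a j) + Polynomial.C (c j) * Polynomial.X)
          (C (if j = i then (1 : K) else 0))) =
        Polynomial.C (c j) * aeval (fun j => Polynomial.C (a j) + Polynomial.C (c j) *
        Polynomial.X) (pderiv j p) * (Polynomial.C (a i) + Polynomial.C (c i) * Polynomial.X) +
        if j = i then aeval (fun j => Polynomial.C (a j) + Polynomial.C (c j) * Polynomial.X) p *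
          Polynomial.C (c j) else 0 := by
      intro j
      split_ifs
      · simp only [map_one]; ring
      · simp only [map_zero]; ring
    simp only [e3, Finset.sum_add_distrib, Finset.sum_ite_eq', Finset.mem_univ, if_true,
      Finset.sum_mul]

theorem separable_of_simple {k : Type*} [Field k] [Algebra k L] (Z : L) (φ : Polynomial k)
    (h0 : Polynomial.aeval Z φ = 0) (h1 : Polynomial.aeval Z (Polynomial.derivative φ) ≠ 0) :
    IsSeparable k Z := by
  have hne : φ ≠ 0 := by rintro rfl; simp at h1
  have hitg : IsIntegral k Z := IsAlgebraic.isIntegral ⟨φ, hne, h0⟩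
  obtain ⟨h, rfl⟩ := minpoly.dvd k Z h0
  rw [Polynomial.derivative_mul] at h1
  simp only [map_add, map_mul, minpoly.aeval, zero_mul, add_zero] at h1
  change (minpoly k Z).Separable
  rw [Polynomial.separable_iff_derivative_ne_zero (minpoly.irreducible hitg)]
  intro h2
  simp [h2] at h1

theorem separable_step {σ : Type*} [Fintype σ] (G : MvPolynomial σ K)
    (c : σ → K) (y' : σ → L) (Z : L) (h0 : aeval (fun j => y' j + c j • Z) G = 0)
    (h1 : ∑ j, c j • aeval (fun j => y' j + c j • Z) (pderiv j G) ≠ 0)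
    (k : IntermediateField K L) (hy : ∀ j, y' j ∈ k) : IsSeparable k Z := by
  let yk : σ → k := fun j => ⟨y' j, hy j⟩
  have key : ∀ H : MvPolynomial σ K, Polynomial.aeval Z (aeval (fun j => Polynomial.C (yk j) +
      Polynomial.C (algebraMap K k (c j)) * Polynomial.X) H) =
      aeval (fun j => y' j + c j • Z) H := by
    intro H
    have : ((Polynomial.aeval Z : Polynomial k →ₐ[k] L).restrictScalars K).comp
      (aeval (fun j => Polynomial.C (yk j) +
      Polynomial.C (algebraMap K k (c j)) * Polynomial.X)) = aeval (fun j => y' j + c j • Z) := by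
      ext j
      simp only [AlgHom.comp_apply, aeval_X, AlgHom.restrictScalars_apply, map_add, map_mul,
        Polynomial.aeval_C, Polynomial.aeval_X]
      rw [Algebra.smul_def]
      rfl
    exact congrArg (fun φ => φ H) this
  refine separable_of_simple Z _ ((key G).trans h0) ?_
  rw [deriv_chain, map_sum]
  simp only [map_mul, key]
  convert h1 using 3 with j
  rw [Algebra.smul_def, Polynomial.aeval_C]; rfl

end step

section noether
variable {K L : Type*} [Field K] [Field L] [Algebra K L]

theorem H_frob [IsAlgClosed K] (p : ℕ) [hp : Fact p.Prime] [CharP K p] : ∀ s : Finset L,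
  LinearIndepOn K _root_.id (s : Set L) → LinearIndepOn K (· ^ p) (s : Set L) := by
  have : ExpChar K p := .prime hp.out
  have : CharP L p := .of_ringHom_of_ne_zero (algebraMap K L) p hp.out.ne_zero
  have : ExpChar L p := .prime hp.out
  intro s hs
  refine hs.map_of_injective_injective (frobeniusEquiv K p).symm (frobenius L p).toAddMonoidHom ?_ ?_ ?_ 
  · intro r; simp
  · intro r; simp
  · intro r m; 
    simp only [Algebra.smul_def, RingHom.toAddMonoidHom_eq_coe, AddMonoidHom.coe_coe, map_mul,
      frobenius_def]
    rw [← map_pow, frobeniusEquiv_symm_pow_p]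

theorem noether_choice [IsAlgClosed K] (p : ℕ) [hp : Fact p.Prime] [CharP K p] {σ : Type*} [Fintype σ] (y : σ → L)
    (hy : ¬ AlgebraicIndependent K y) : ∃ (G : MvPolynomial σ K) (c : σ → K),
      aeval y G = 0 ∧ eval c (homogeneousComponent G.totalDegree G) ≠ 0 ∧
      ∑ j, c j • aeval y (pderiv j G) ≠ 0 ∧ c ≠ 0 := by
  classical
  have hCL : CharP L p := .of_ringHom_of_ne_zero (algebraMap K L) p hp.out.ne_zero
  rw [algebraicIndependent_iff] at hy
  push Not at hy
  have hS : {G : MvPolynomial σ K | aeval y G = 0 ∧ G ≠ 0}.Nonempty := hy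
  obtain ⟨G, ⟨hG0, hG1⟩, hmin⟩ : ∃ G ∈ {G : MvPolynomial σ K | aeval y G = 0 ∧ G ≠ 0},
      ∀ H : MvPolynomial σ K, H ≠ 0 → aeval y H = 0 → totalDegree G ≤ totalDegree H :=
    ⟨totalDegree.argminOn _ hS, totalDegree.argminOn_mem .., fun _ h₁ h₂ =>
      totalDegree.argminOn_le _ (show _ ∈ {G : MvPolynomial σ K | aeval y G = 0 ∧ G ≠ 0}
        from ⟨h₂, h₁⟩)⟩
  obtain ⟨i, α, hα, hi⟩ := exists_mem_support_not_dvd_of_forall_totalDegree_le p hp.out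
    (H_frob (L := L) p) hmin hG1 hG0
  have hpd : pderiv i G ≠ 0 := by
    intro h
    have h1 := coeff_pderiv (i := i) G (α - Finsupp.single i 1)
    have hαi : α i ≠ 0 := by rintro h; simp [h] at hi
    have h2 : α - Finsupp.single i 1 + Finsupp.single i 1 = α :=
      tsub_add_cancel_of_le (Finsupp.single_le_iff.2 (Nat.pos_of_ne_zero hαi))
    rw [h, h2, coeff_zero] at h1
    have h3 : (((α - Finsupp.single i 1 : σ →₀ ℕ) i : ℕ) : K) + 1 = (α i : ℕ) := by
      conv_rhs => rw [← h2]
      rw [Finsupp.add_apply, Finsupp.single_eq_same]; push_cast; rfl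
    rw [h3] at h1
    rcases mul_eq_zero.1 h1.symm with h4 | h4
    · exact (mem_support_iff.1 hα) h4
    · exact hi ((CharP.cast_eq_zero_iff K p _).1 h4)
  have hdeg : (pderiv i G).totalDegree < G.totalDegree := by
    have : ∀ m ∈ (pderiv i G).support, m.degree + 1 ≤ G.totalDegree := by
      intro m hm
      rw [mem_support_iff, coeff_pderiv] at hm
      have : m + Finsupp.single i 1 ∈ G.support := mem_support_iff.2 (left_ne_zero_of_mul hm)
      have := le_totalDegree this
      rw [Finsupp.sum_fintype _ _ (fun _ => rfl), ← Finsupp.degree_eq_sum, map_add] at this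
      simpa using this
    obtain ⟨m, hm⟩ := support_nonempty.2 hpd
    have h0 := this m hm
    rw [Nat.lt_iff_add_one_le]
    have : (pderiv i G).totalDegree ≤ G.totalDegree - 1 := by
      refine Finset.sup_le fun m hm => ?_
      rw [Finsupp.sum_fintype _ _ (fun _ => rfl), ← Finsupp.degree_eq_sum]
      have := this m hm; omega
    omega
  have hpy : aeval y (pderiv i G) ≠ 0 := fun h => absurd (hmin _ hpd h) (by omega)
  have htop : homogeneousComponent G.totalDegree G ≠ 0 := by
    obtain ⟨m, hm, hm'⟩ := Finset.exists_mem_eq_sup G.support (support_nonempty.2 hG1)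
      (fun s => s.sum fun _ e => e)
    intro h
    have := congrArg (coeff m) h
    rw [coeff_homogeneousComponent, if_pos, coeff_zero] at this
    · exact mem_support_iff.1 hm this
    · rw [totalDegree, hm', Finsupp.sum_fintype _ _ (fun _ => rfl), Finsupp.degree_eq_sum]
  let Q : MvPolynomial σ L := map (algebraMap K L) (homogeneousComponent G.totalDegree G) *
    ∑ j, C (aeval y (pderiv j G)) * X j
  have hQ : Q ≠ 0 := by
    refine mul_ne_zero ?_ ?_
    · rwa [Ne, map_eq_zero_iff _ (map_injective _ (algebraMap K L).injective)]
    · intro h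
      have := congrArg (coeff (Finsupp.single i 1)) h
      rw [coeff_sum, Finset.sum_eq_single i] at this
      · rw [coeff_C_mul, coeff_X, if_pos rfl, mul_one] at this
        exact hpy this
      · intro j _ hj
        rw [coeff_C_mul, coeff_X, if_neg, mul_zero]
        simpa [Finsupp.single_left_inj] using hj
      · simp
  have hinf : (Set.range (algebraMap K L)).Infinite :=
    Set.infinite_range_of_injective (algebraMap K L).injective
  obtain ⟨c', hc', hne⟩ : ∃ x ∈ Set.pi Set.univ (fun _ : σ => Set.range (algebraMap K L)),
      eval x Q ≠ 0 := by
    by_contra! h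
    exact hQ (funext_set (fun _ => Set.range (algebraMap K L)) (fun _ => hinf)
      (fun x hx => by rw [h x hx, map_zero]))
  choose c hc using fun j => hc' j (Set.mem_univ j)
  have hcc : c' = fun j => algebraMap K L (c j) := funext fun j => (hc j).symm
  rw [hcc, map_mul, mul_ne_zero_iff] at hne
  have h2 : ∑ j, c j • aeval y (pderiv j G) ≠ 0 := by
    convert hne.2 using 1
    rw [map_sum]
    refine Finset.sum_congr rfl fun j _ => ?_
    rw [map_mul, eval_C, eval_X, Algebra.smul_def, mul_comm]
  refine ⟨G, c, hG0, ?_, h2, ?_⟩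
  · intro h
    apply hne.1
    rw [eval_map]
    have := congrArg (algebraMap K L) h
    rw [map_zero] at this
    rw [← this, ← coe_eval₂Hom, eval, ← RingHom.comp_apply, comp_eval₂Hom]
    rfl
  · rintro rfl
    simp at h2

theorem rees_le {ι : Type*} (y : ι → L) (S : Subalgebra K (Polynomial L))
    (hX : Polynomial.X ∈ S) (h : ∀ i, Polynomial.X * Polynomial.C (y i) ∈ S) : rees K y ≤ S := by
  refine Algebra.adjoin_le ?_
  rintro _ (rfl | ⟨i, rfl⟩)
  exacts [hX, h i]

theorem X_mem_rees {ι : Type*} (y : ι → L) : Polynomial.X ∈ rees K y :=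
  Algebra.subset_adjoin (Or.inl rfl)

theorem XC_mem_rees {ι : Type*} (y : ι → L) (i : ι) :
    Polynomial.X * Polynomial.C (y i) ∈ rees K y :=
  Algebra.subset_adjoin (Or.inr ⟨i, rfl⟩)

theorem rees_trans {ι κ : Type*} (y : ι → L) (y' : κ → L)
    (h : ∀ i, IsIntegral (rees K y') (Polynomial.X * Polynomial.C (y i))) (a : Polynomial L)
    (ha : IsIntegral (rees K y) a) : IsIntegral (rees K y') a := by
  let B := integralClosure (rees K y') (Polynomial L)
  have hle : rees K y ≤ B.restrictScalars K := by
    refine Algebra.adjoin_le ?_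
    rintro _ (rfl | ⟨i, rfl⟩)
    · exact isIntegral_algebraMap (x := (⟨_, X_mem_rees y'⟩ : rees K y'))
    · exact h i
  have : IsIntegral B a := by
    obtain ⟨f, hf, hf0⟩ := ha
    let φ : rees K y →+* B := (Subalgebra.inclusion hle).toRingHom
    refine ⟨f.map φ, hf.map _, ?_⟩
    rw [Polynomial.eval₂_map]
    exact hf0
  exact isIntegral_trans a this

theorem sep_trans (k k' : IntermediateField K L) (h : ∀ a ∈ k, IsSeparable k' a) (a : L)
    (ha : IsSeparable k a) : IsSeparable k' a :=
  (separableClosure_le_separableClosure_iff (F := K) (E := L) (K := k') (L := k)).2 h ha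

theorem adjoin_sep (s : Set L) (k' : IntermediateField K L) (h : ∀ a ∈ s, IsSeparable k' a) :
    ∀ a ∈ IntermediateField.adjoin K s, IsSeparable k' a := by
  have : IntermediateField.adjoin K s ≤ (separableClosure k' L).restrictScalars K :=
    IntermediateField.adjoin_le_iff.2 h
  exact this

theorem noether [IsAlgClosed K] (p : ℕ) [hp : Fact p.Prime] [CharP K p] : ∀ (m : ℕ) (y : Fin m → L),
    ∃ (r : ℕ) (c : Fin r → Fin m → K), AlgebraicIndependent K (fun i => ∑ j, c i j • y j) ∧
      (∀ j, IsIntegral (rees K (fun i => ∑ j, c i j • y j)) (Polynomial.X * Polynomial.C (y j))) ∧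
      (∀ j, IsSeparable (IntermediateField.adjoin K (Set.range (fun i => ∑ j, c i j • y j)))
        (y j)) := by
  classical
  have hid : ∀ (m : ℕ) (y : Fin m → L), AlgebraicIndependent K y →
    ∃ (r : ℕ) (c : Fin r → Fin m → K), AlgebraicIndependent K (fun i => ∑ j, c i j • y j) ∧
      (∀ j, IsIntegral (rees K (fun i => ∑ j, c i j • y j)) (Polynomial.X * Polynomial.C (y j))) ∧
      (∀ j, IsSeparable (IntermediateField.adjoin K (Set.range (fun i => ∑ j, c i j • y j)))
        (y j)) := by
    intro m y hy
    have e : (fun i => ∑ j, (if i = j then (1:K) else 0) • y j) = y := by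
      funext i; simp
    refine ⟨m, fun i j => if i = j then 1 else 0, ?_⟩
    rw [e]
    refine ⟨hy, fun j => isIntegral_algebraMap (x := (⟨_, XC_mem_rees y j⟩ : rees K y)),
      fun j => isSeparable_algebraMap (F := IntermediateField.adjoin K (Set.range y))
        ⟨y j, IntermediateField.subset_adjoin _ _ ⟨j, rfl⟩⟩⟩
  intro m
  induction m with
  | zero =>
    intro y
    exact hid 0 y (algebraicIndependent_empty_type_iff.2 (algebraMap K L).injective)
  | succ m ih =>
    intro y
    by_cases hy : AlgebraicIndependent K y
    · exact hid _ y hy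
    obtain ⟨G, c, hG0, hG1, hG2, hc⟩ := noether_choice p y hy
    obtain ⟨l, hl⟩ := Function.ne_iff.1 hc
    simp only [Pi.zero_apply] at hl
    set Z : L := (c l)⁻¹ • y l with hZ
    let yf : Fin (m+1) → L := fun j => y j - c j • Z
    let y' : Fin m → L := fun j => yf (l.succAbove j)
    have hyf : (fun j => yf j + c j • Z) = y := by funext j; simp [yf]
    have hl0 : yf l = 0 := by simp [yf, hZ, smul_smul, mul_inv_cancel₀ hl]
    have hZint : IsIntegral (rees K y') (Polynomial.X * Polynomial.C Z) := by
      refine integral_step G _ le_rfl c hG1 yf Z (by rw [hyf]; exact hG0) _ (X_mem_rees _) ?_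
      intro j
      rcases Fin.eq_self_or_eq_succAbove l j with rfl | ⟨i, rfl⟩
      · rw [hl0]; simp
      · exact XC_mem_rees y' i
    have hZsep : IsSeparable (IntermediateField.adjoin K (Set.range y')) Z := by
      refine separable_step G c yf Z (by rw [hyf]; exact hG0) (by rw [hyf]; exact hG2) _ ?_
      intro j
      rcases Fin.eq_self_or_eq_succAbove l j with rfl | ⟨i, rfl⟩
      · rw [hl0]; exact zero_mem _
      · exact IntermediateField.subset_adjoin _ _ ⟨i, rfl⟩
    obtain ⟨r, c', h1, h2, h3⟩ := ih y'
    let d : Fin r → Fin (m+1) → K := fun i => Fin.insertNth l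
      (-(c l)⁻¹ * ∑ j, c' i j * c (l.succAbove j)) (c' i)
    have hd : (fun i => ∑ j, d i j • y j) = fun i => ∑ j, c' i j • y' j := by
      funext i
      rw [Fin.sum_univ_succAbove _ l]
      simp only [d, Fin.insertNth_apply_same, Fin.insertNth_apply_succAbove, y', yf, smul_sub,
        Finset.sum_sub_distrib, hZ, smul_smul]
      rw [← Finset.sum_smul, add_comm, sub_eq_add_neg, ← neg_smul]
      congr 2
      rw [Finset.mul_sum, ← Finset.sum_neg_distrib]
      refine Finset.sum_congr rfl fun j _ => ?_
      ring
    refine ⟨r, d, ?_⟩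
    rw [hd]
    have hyi : ∀ j, IsIntegral (rees K y') (Polynomial.X * Polynomial.C (yf j)) := by
      intro j
      rcases Fin.eq_self_or_eq_succAbove l j with rfl | ⟨i, rfl⟩
      · rw [hl0, map_zero, mul_zero]; exact isIntegral_zero
      · exact isIntegral_algebraMap (x := (⟨_, XC_mem_rees y' i⟩ : rees K y'))
    have hys : ∀ j, IsSeparable (IntermediateField.adjoin K (Set.range y')) (yf j) := by
      intro j
      rcases Fin.eq_self_or_eq_succAbove l j with rfl | ⟨i, rfl⟩
      · rw [hl0]; exact zero_mem (separableClosure (IntermediateField.adjoin K (Set.range y')) L)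
      · exact isSeparable_algebraMap (F := IntermediateField.adjoin K (Set.range y'))
          ⟨y' i, IntermediateField.subset_adjoin _ _ ⟨i, rfl⟩⟩
    refine ⟨h1, fun j => ?_, fun j => ?_⟩
    · refine rees_trans y' _ h2 _ ?_
      have : Polynomial.X * Polynomial.C (y j) = Polynomial.X * Polynomial.C (yf j) +
          (algebraMap K (rees K y') (c j)) • (Polynomial.X * Polynomial.C Z) := by
        rw [← congrFun hyf j, map_add, mul_add, algebraMap_smul, ← Polynomial.smul_C,
          mul_smul_comm]
      rw [this]
      exact (hyi j).add (hZint.smul _)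
    · refine sep_trans (IntermediateField.adjoin K (Set.range y')) _ (adjoin_sep _ _ ?_) _ ?_
      · rintro _ ⟨i, rfl⟩; exact h3 i
      · rw [← congrFun hyf j]
        refine add_mem (S := IntermediateField _ L) (s := separableClosure
          (IntermediateField.adjoin K (Set.range y')) L) (hys j) ?_
        have h4 : c j • Z = (algebraMap K (IntermediateField.adjoin K (Set.range y')) (c j)) • Z := by
          rw [algebraMap_smul]
        rw [h4]
        exact (separableClosure (IntermediateField.adjoin K (Set.range y')) L).smul_mem hZsep

end noether
end RSV


namespace RSV

section weights
variable {K L : Type*} [Field K] [Field L] [Algebra K L]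

/-- `f` has weight at most `D` over the tuple `y`. -/
def Wt (K : Type*) {L ι : Type*} [Field K] [Field L] [Algebra K L] (y : ι → L) (D : ℕ) (f : L) :
    Prop := IsIntegral (rees K y) (Polynomial.X ^ D * Polynomial.C f)

theorem degree_le_of_mem {σ : Type*} [Fintype σ] {D : ℕ} {R : Type*} [CommRing R]
    {g : MvPolynomial σ R} (hg : g.totalDegree ≤ D)
    {α : σ →₀ ℕ} (hα : α ∈ g.support) : ∑ j, α j ≤ D := by
  refine le_trans ?_ hg
  have := le_totalDegree hα
  rwa [Finsupp.sum_fintype _ _ (fun _ => rfl)] at this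

theorem wt_aeval {ι σ : Type*} [Fintype σ] (y : ι → L) (x : σ → L) (hx : ∀ j, Wt K y 1 (x j))
    (D : ℕ) (g : MvPolynomial σ K) (hg : g.totalDegree ≤ D) : Wt K y D (aeval x g) := by
  classical
  have hX : IsIntegral (rees K y) (Polynomial.X : Polynomial L) :=
    isIntegral_algebraMap (x := (⟨_, X_mem_rees y⟩ : rees K y))
  have key : Polynomial.X ^ D * Polynomial.C (aeval x g) = ∑ α ∈ g.support,
      (algebraMap K (rees K y) (coeff α g)) • (Polynomial.X ^ (D - ∑ j, α j) *
        ∏ j, (Polynomial.X ^ 1 * Polynomial.C (x j)) ^ α j) := by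
    conv_lhs => rw [g.as_sum]
    simp only [map_sum, aeval_monomial, Finset.mul_sum]
    refine Finset.sum_congr rfl fun α hα => ?_
    obtain ⟨b, hb⟩ := Nat.exists_eq_add_of_le (degree_le_of_mem hg hα)
    simp only [mul_pow, Finset.prod_mul_distrib, Finset.prod_pow_eq_pow_sum, pow_one]
    rw [Finsupp.prod_fintype _ _ (fun _ => pow_zero _), algebraMap_smul, Algebra.smul_def,
      hb, Nat.add_sub_cancel_left, pow_add, map_mul, map_prod]
    simp only [map_pow]
    have : algebraMap K (Polynomial L) (coeff α g) = Polynomial.C (algebraMap K L (coeff α g)) := rfl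
    rw [this]; ring
  rw [Wt, key]
  refine IsIntegral.sum _ fun α _ => IsIntegral.smul _ ((hX.pow _).mul ?_)
  exact IsIntegral.prod _ fun j _ => (hx j).pow _

variable {σ : Type*} [Fintype σ] [Algebra (MvPolynomial σ K) L] [IsScalarTower K (MvPolynomial σ K) L]

theorem rees_coeff (a : Polynomial L)
    (ha : a ∈ rees K (fun i : σ => algebraMap (MvPolynomial σ K) L (X i))) :
    ∀ ℓ, ∃ b : MvPolynomial σ K, b.totalDegree ≤ ℓ ∧ algebraMap _ L b = a.coeff ℓ := by
  unfold rees at ha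
  induction ha using Algebra.adjoin_induction with
  | mem z hz =>
    intro ℓ
    rcases hz with rfl | ⟨i, rfl⟩
    · by_cases h : ℓ = 1
      · exact ⟨1, by simp, by simp [h]⟩
      · exact ⟨0, by simp, by simp [Polynomial.coeff_X, Ne.symm h]⟩
    · by_cases h : ℓ = 1
      · exact ⟨X i, by simp [h], by simp [h]⟩
      · exact ⟨0, by simp, by simp [Polynomial.coeff_X, Ne.symm h]⟩
  | algebraMap c =>
    intro ℓ
    by_cases h : ℓ = 0
    · refine ⟨C c, by simp, ?_⟩
      rw [h, ← algebraMap_eq, ← IsScalarTower.algebraMap_apply, Polynomial.algebraMap_apply,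
        Polynomial.coeff_C_zero]
    · refine ⟨0, by simp, ?_⟩
      rw [Polynomial.algebraMap_apply, Polynomial.coeff_C_of_ne_zero h, map_zero]
  | add p q _ _ hp hq =>
    intro ℓ
    obtain ⟨b, hb, hb'⟩ := hp ℓ
    obtain ⟨c, hc, hc'⟩ := hq ℓ
    exact ⟨b + c, (totalDegree_add _ _).trans (max_le hb hc), by simp [hb', hc']⟩
  | mul p q _ _ hp hq =>
    intro ℓ
    choose b hb hb' using hp
    choose c hc hc' using hq
    refine ⟨∑ x ∈ Finset.HasAntidiagonal.antidiagonal ℓ, b x.1 * c x.2, ?_, ?_⟩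
    · refine totalDegree_finsetSum_le fun x hx => ?_
      refine (totalDegree_mul _ _).trans ?_
      rw [← Finset.HasAntidiagonal.mem_antidiagonal.1 hx]
      exact add_le_add (hb _) (hc _)
    · rw [Polynomial.coeff_mul, map_sum]
      refine Finset.sum_congr rfl fun x _ => ?_
      rw [map_mul, hb', hc']

theorem exists_weighted (f : L) (D : ℕ)
    (hf : Wt K (fun i : σ => algebraMap (MvPolynomial σ K) L (X i)) D f) :
    ∃ Ψ : Polynomial (MvPolynomial σ K), Ψ.Monic ∧ Polynomial.aeval f Ψ = 0 ∧
      ∀ i ≤ Ψ.natDegree, (Ψ.coeff i).totalDegree ≤ (Ψ.natDegree - i) * D := by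
  classical
  obtain ⟨Φ, hΦ, h0⟩ := hf
  set M := Φ.natDegree with hM
  choose b hb hb' using fun i => rees_coeff (Φ.coeff i : Polynomial L) (Φ.coeff i).2 ((M - i) * D)
  let Q : Polynomial (MvPolynomial σ K) := ∑ i ∈ Finset.range M, Polynomial.C (b i) * Polynomial.X ^ i
  have hQ : Q.degree < M := by
    refine (Polynomial.degree_sum_le _ _).trans_lt ((Finset.sup_lt_iff (WithBot.bot_lt_coe M)).2 ?_)
    intro i hi
    exact (Polynomial.degree_C_mul_X_pow_le _ _).trans_lt (WithBot.coe_lt_coe.2 (Finset.mem_range.1 hi))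
  have hmon : (Polynomial.X ^ M + Q).Monic := Polynomial.monic_X_pow_add hQ
  have hnat : (Polynomial.X ^ M + Q).natDegree = M := by
    rw [Polynomial.natDegree_add_eq_left_of_degree_lt]
    · simp
    · simpa using hQ
  refine ⟨Polynomial.X ^ M + Q, hmon, ?_, ?_⟩
  · have h1 := congrArg (fun a : Polynomial L => a.coeff (M * D)) h0
    simp only [Polynomial.coeff_zero] at h1
    rw [Polynomial.eval₂_eq_sum_range, Finset.sum_range_succ, ← hM, hΦ.coeff_natDegree] at h1
    rw [map_one, one_mul, Polynomial.coeff_add, Polynomial.finsetSum_coeff] at h1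
    rw [map_add, map_sum, add_comm, ← h1]
    congr 1
    · refine Finset.sum_congr rfl fun i hi => ?_
      rw [map_mul, Polynomial.aeval_C, hb', map_pow, Polynomial.aeval_X, mul_pow, ← map_pow,
        ← mul_assoc, Polynomial.coeff_mul_C, ← pow_mul]
      congr 1
      have : M * D = (M - i) * D + D * i := by
        rw [mul_comm D i, ← add_mul, Nat.sub_add_cancel (Finset.mem_range.1 hi).le]
      rw [this, Polynomial.coeff_mul_X_pow]
      rfl
    · rw [mul_pow, ← map_pow, Polynomial.coeff_mul_C, ← pow_mul, mul_comm D M,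
        Polynomial.coeff_X_pow_self, one_mul, map_pow, Polynomial.aeval_X]
  · intro i hi
    rw [hnat] at hi ⊢
    rw [Polynomial.coeff_add, Polynomial.coeff_X_pow]
    by_cases h : i = M
    · subst h
      rw [Polynomial.coeff_eq_zero_of_degree_lt hQ]; simp
    · have hlt : i < M := lt_of_le_of_ne hi h
      rw [if_neg h, zero_add, Polynomial.finsetSum_coeff]
      simp only [Polynomial.coeff_C_mul_X_pow]
      rw [Finset.sum_ite_eq, if_pos (Finset.mem_range.2 hlt)]
      exact hb i

/-- the weight-grading homomorphism -/
noncomputable def theta (K σ : Type*) [Field K] (D : ℕ) :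
    Polynomial (MvPolynomial σ K) →+* Polynomial (Polynomial (MvPolynomial σ K)) :=
  Polynomial.eval₂RingHom
    (aeval (R := K) fun j => Polynomial.X * Polynomial.C (Polynomial.C (X j))).toRingHom
    (Polynomial.X ^ D * Polynomial.C Polynomial.X)

theorem mulpow (a b : Polynomial (Polynomial (MvPolynomial σ K))) (n : ℕ) :
    (a * b) ^ n = a ^ n * b ^ n := mul_pow a b n

theorem theta_C_coeff (D : ℕ) (a : MvPolynomial σ K) (ℓ : ℕ) :
    ((theta K σ D (Polynomial.C a)).coeff ℓ) = Polynomial.C (homogeneousComponent ℓ a) := by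
  classical
  induction a using MvPolynomial.induction_on' with
  | add p q hp hq => simp only [map_add, Polynomial.coeff_add, hp, hq]
  | monomial α c =>
    have h1 : theta K σ D (Polynomial.C (monomial α c)) =
        Polynomial.X ^ (∑ j, α j) * Polynomial.C (Polynomial.C (monomial α c)) := by
      simp only [theta, Polynomial.coe_eval₂RingHom, Polynomial.eval₂_C, AlgHom.toRingHom_eq_coe,
        RingHom.coe_coe, aeval_monomial]
      rw [Finsupp.prod_fintype _ _ (fun _ => pow_zero _)]
      simp only [mulpow, Finset.prod_mul_distrib, Finset.prod_pow_eq_pow_sum]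
      refine (mul_left_comm (G := Polynomial (Polynomial (MvPolynomial σ K))) _ _ _).trans ?_
      congr 1
      rw [monomial_eq, Finsupp.prod_fintype _ _ (fun _ => pow_zero _)]
      simp only [map_mul, map_prod, map_pow]
      rfl
    rw [h1, Polynomial.coeff_mul_C, Polynomial.coeff_X_pow, homogeneousComponent_apply]
    by_cases hc : c = 0
    · simp [hc]
    rw [support_monomial, if_neg hc, Finset.filter_singleton, Finsupp.degree_eq_sum]
    by_cases h : ∑ j, α j = ℓ
    · simp [h]
    · simp [h, Ne.symm h]

theorem theta_coeff (D : ℕ) (P : Polynomial (MvPolynomial σ K)) (ℓ i : ℕ) :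
    ((theta K σ D P).coeff (ℓ + D * i)).coeff i = homogeneousComponent ℓ (P.coeff i) := by
  classical
  induction P using Polynomial.induction_on' with
  | add p q hp hq => simp only [map_add, Polynomial.coeff_add, hp, hq]
  | monomial m a =>
    have h1 : theta K σ D (Polynomial.monomial m a) = theta K σ D (Polynomial.C a) *
        Polynomial.C (Polynomial.X ^ m) * Polynomial.X ^ (D * m) := by
      rw [← Polynomial.C_mul_X_pow_eq_monomial, map_mul, map_pow]
      have : theta K σ D Polynomial.X = Polynomial.X ^ D * Polynomial.C Polynomial.X := by
        simp [theta]
      rw [this, mulpow, ← pow_mul, ← map_pow]; ring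
    rw [h1, Polynomial.coeff_mul_X_pow', Polynomial.coeff_monomial]
    by_cases h : m = i
    · subst h
      rw [if_pos (Nat.le_add_left _ _), Nat.add_sub_cancel, Polynomial.coeff_mul_C, theta_C_coeff,
        Polynomial.coeff_C_mul_X_pow]
      simp
    · rw [if_neg h, map_zero]
      split_ifs
      · rw [Polynomial.coeff_mul_C, theta_C_coeff, Polynomial.coeff_C_mul_X_pow,
          if_neg (Ne.symm h)]
      · simp

theorem theta_ne_zero (D : ℕ) (P : Polynomial (MvPolynomial σ K)) (hP : P.Monic) :
    D * P.natDegree ≤ (theta K σ D P).natDegree := by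
  apply Polynomial.le_natDegree_of_ne_zero
  intro h
  have := theta_coeff D P 0 P.natDegree
  rw [zero_add, h, hP.coeff_natDegree, homogeneousComponent_zero] at this
  simp at this

theorem theta_natDegree_le (D N : ℕ) (P : Polynomial (MvPolynomial σ K)) :
    (theta K σ D P).natDegree ≤ N ↔ ∀ i, P.coeff i ≠ 0 → (P.coeff i).totalDegree + D * i ≤ N := by
  constructor
  · intro h i hi
    by_contra! hlt
    obtain ⟨m, hm, hm'⟩ := Finset.exists_mem_eq_sup (P.coeff i).support (support_nonempty.2 hi)
      (fun s => s.sum fun _ e => e)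
    have h1 := theta_coeff D P (P.coeff i).totalDegree i
    rw [Polynomial.coeff_eq_zero_of_natDegree_lt (h.trans_lt hlt), Polynomial.coeff_zero] at h1
    have := congrArg (coeff m) h1
    rw [coeff_homogeneousComponent, if_pos, coeff_zero] at this
    · exact mem_support_iff.1 hm this.symm
    · rw [totalDegree, hm', Finsupp.sum_fintype _ _ (fun _ => rfl), Finsupp.degree_eq_sum]
  · intro h
    rw [P.as_sum_support, map_sum]
    refine Polynomial.natDegree_sum_le_of_forall_le _ _ fun i hi => ?_
    have h1 : theta K σ D (Polynomial.monomial i (P.coeff i)) = theta K σ D (Polynomial.C (P.coeff i)) *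
        Polynomial.C (Polynomial.X ^ i) * Polynomial.X ^ (D * i) := by
      rw [← Polynomial.C_mul_X_pow_eq_monomial, map_mul, map_pow]
      have : theta K σ D Polynomial.X = Polynomial.X ^ D * Polynomial.C Polynomial.X := by
        simp [theta]
      rw [this, mulpow, ← pow_mul, ← map_pow]; ring
    rw [h1]
    refine Polynomial.natDegree_mul_le.trans ?_
    rw [Polynomial.natDegree_X_pow]
    refine le_trans (Nat.add_le_add_right ?_ _) (h i (Polynomial.mem_support_iff.1 hi))
    refine (Polynomial.natDegree_mul_C_le _ _).trans ?_
    rw [Polynomial.natDegree_le_iff_coeff_eq_zero]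
    intro ℓ hℓ
    rw [theta_C_coeff, homogeneousComponent_eq_zero _ _ hℓ, map_zero]

theorem weighted_of_dvd (D : ℕ) (P Ψ : Polynomial (MvPolynomial σ K)) (hP : P.Monic)
    (hΨ : Ψ.Monic) (hd : P ∣ Ψ)
    (h : ∀ i ≤ Ψ.natDegree, (Ψ.coeff i).totalDegree ≤ (Ψ.natDegree - i) * D) :
    ∀ i ≤ P.natDegree, (P.coeff i).totalDegree ≤ (P.natDegree - i) * D := by
  obtain ⟨Q, rfl⟩ := hd
  have hQ : Q.Monic := hP.of_mul_monic_left hΨ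
  have hnat : (P * Q).natDegree = P.natDegree + Q.natDegree := hP.natDegree_mul hQ
  have h1 : (theta K σ D (P * Q)).natDegree ≤ D * (P * Q).natDegree := by
    rw [theta_natDegree_le]
    intro i hi
    have hi' := Polynomial.le_natDegree_of_ne_zero hi
    obtain ⟨b, hb⟩ := Nat.exists_eq_add_of_le hi'
    have := h i hi'
    rw [hb, Nat.add_sub_cancel_left] at this
    rw [hb]; nlinarith
  have hne : ∀ P : Polynomial (MvPolynomial σ K), P.Monic → theta K σ D P ≠ 0 := by
    intro P hP h0
    have := theta_coeff D P 0 P.natDegree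
    rw [h0, hP.coeff_natDegree, homogeneousComponent_zero] at this
    simp at this
  rw [map_mul, Polynomial.natDegree_mul (hne P hP) (hne Q hQ), hnat] at h1
  have h2 := theta_ne_zero D Q hQ
  have h3 : (theta K σ D P).natDegree ≤ D * P.natDegree := by nlinarith
  rw [theta_natDegree_le] at h3
  intro i hi
  by_cases h0 : P.coeff i = 0
  · simp [h0]
  have := h3 i h0
  obtain ⟨b, hb⟩ := Nat.exists_eq_add_of_le hi
  rw [hb] at this ⊢
  rw [Nat.add_sub_cancel_left]
  nlinarith

theorem wt_minpoly [FaithfulSMul (MvPolynomial σ K) L] (f : L) (D : ℕ)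
    (hf : Wt K (fun i : σ => algebraMap (MvPolynomial σ K) L (X i)) D f) :
    IsIntegral (MvPolynomial σ K) f ∧ ∀ i ≤ (minpoly (MvPolynomial σ K) f).natDegree,
      ((minpoly (MvPolynomial σ K) f).coeff i).totalDegree ≤
        ((minpoly (MvPolynomial σ K) f).natDegree - i) * D := by
  obtain ⟨Ψ, h1, h2, h3⟩ := exists_weighted f D hf
  have hitg : IsIntegral (MvPolynomial σ K) f := ⟨Ψ, h1, h2⟩
  have : Module.IsTorsionFree (MvPolynomial σ K) L := inferInstance
  exact ⟨hitg, weighted_of_dvd D _ Ψ (minpoly.monic hitg) h1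
    (minpoly.isIntegrallyClosed_dvd hitg h2) h3⟩

end weights
end RSV


namespace RSV
set_option linter.all false
set_option linter.unusedSectionVars false
set_option linter.unusedSimpArgs false
set_option linter.style.haveILetI false

/-- exponents of degree at most `D` -/
noncomputable def expo (r D : ℕ) : Finset (Fin r →₀ ℕ) :=
  (Finset.range (D + 1)).biUnion fun n => (Finset.univ : Finset (Fin r)).finsuppAntidiag n

theorem mem_expo {r D : ℕ} {α : Fin r →₀ ℕ} : α ∈ expo r D ↔ ∑ j, α j ≤ D := by
  simp [expo, Finset.mem_finsuppAntidiag, Nat.lt_succ_iff]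

theorem card_expo (r D : ℕ) : (expo r D).card = (D + r).choose r := by
  rw [expo, Finset.card_biUnion]
  · simp only [Finset.card_finsuppAntidiag_nat_eq_choose, Finset.card_univ, Fintype.card_fin]
    rw [Nat.choose_symm_add.symm]
    induction D with
    | zero => simp
    | succ D ih =>
      rw [Finset.sum_range_succ, ih]
      rcases r with _ | r
      · simp
      · have e : r + 1 + (D + 1) - 1 = r + D + 1 := by omega
        rw [e, show D + (r + 1) = r + D + 1 by ring, show D + 1 + (r + 1) = (r + D + 1) + 1 by ring,
          Nat.choose_succ_succ' (r + D + 1) D]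
  · intro a _ b _ hab
    rw [Function.onFun, Finset.disjoint_left]
    intro α ha hb
    rw [Finset.mem_finsuppAntidiag] at ha hb
    exact hab (ha.1.symm.trans hb.1)

section norm
variable {K L k : Type*} [Field K] [Field L] [Field k] [Algebra K L]
  {σ : Type*} [Fintype σ] [Algebra (MvPolynomial σ K) L] [IsScalarTower K (MvPolynomial σ K) L]
  [Algebra (MvPolynomial σ K) k] [IsFractionRing (MvPolynomial σ K) k] [Algebra k L]
  [IsScalarTower (MvPolynomial σ K) k L] [FiniteDimensional k L]

theorem faithful_of_frac (K L k σ : Type*) [Field K] [Field L] [Field k]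
    [Algebra (MvPolynomial σ K) L] [Algebra (MvPolynomial σ K) k]
    [IsFractionRing (MvPolynomial σ K) k] [Algebra k L] [IsScalarTower (MvPolynomial σ K) k L] : FaithfulSMul (MvPolynomial σ K) L := by
  rw [faithfulSMul_iff_algebraMap_injective, IsScalarTower.algebraMap_eq (MvPolynomial σ K) k L]
  exact (algebraMap k L).injective.comp (IsFractionRing.injective _ _)

open IntermediateField in
theorem exists_norm (f : L) (hf : f ≠ 0) (D : ℕ)
    (hW : Wt K (fun i : σ => algebraMap (MvPolynomial σ K) L (X i)) D f) :
    ∃ ν : MvPolynomial σ K, ν ≠ 0 ∧ ν.totalDegree ≤ Module.finrank k L * D ∧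
      algebraMap _ k ν = Algebra.norm k f := by
  haveI := faithful_of_frac K L k σ
  obtain ⟨hitg, hw⟩ := wt_minpoly f D hW
  have hmin := minpoly.isIntegrallyClosed_eq_field_fractions' k hitg
  have hintk : IsIntegral k f := hitg.tower_top
  let m := (minpoly (MvPolynomial σ K) f).natDegree
  have hm : m = Module.finrank k k⟮f⟯ := by
    rw [IntermediateField.adjoin.finrank hintk, hmin, (minpoly.monic hitg).natDegree_map]
  have hnorm : algebraMap (MvPolynomial σ K) k (((-1) ^ m *
      (minpoly (MvPolynomial σ K) f).coeff 0) ^ Module.finrank k⟮f⟯ L) = Algebra.norm k f := by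
    rw [Algebra.norm_eq_norm_adjoin]
    have h1 := Algebra.PowerBasis.norm_gen_eq_coeff_zero_minpoly (IntermediateField.adjoin.powerBasis hintk)
    rw [IntermediateField.adjoin.powerBasis_gen, IntermediateField.minpoly_gen, hmin,
      Polynomial.coeff_map, IntermediateField.adjoin.powerBasis_dim, hmin,
      (minpoly.monic hitg).natDegree_map] at h1
    rw [h1]
    simp [m]
  refine ⟨_, ?_, ?_, hnorm⟩
  · intro h
    rw [h, map_zero] at hnorm
    exact hf (Algebra.norm_eq_zero_iff.1 hnorm.symm)
  · refine (totalDegree_pow _ _).trans ?_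
    rw [← Module.finrank_mul_finrank k k⟮f⟯ L, ← hm, mul_comm m, mul_assoc]
    refine Nat.mul_le_mul_left _ ?_
    have h1 : ((-1 : MvPolynomial σ K) ^ m * (minpoly (MvPolynomial σ K) f).coeff 0) =
        C ((-1) ^ m) * (minpoly (MvPolynomial σ K) f).coeff 0 := by simp
    rw [h1]
    refine (totalDegree_mul _ _).trans ?_
    rw [totalDegree_C, zero_add]
    exact hw 0 (Nat.zero_le _)

theorem exists_matrix (pb : PowerBasis k L) (hz : IsIntegral (MvPolynomial σ K) pb.gen) :
    ∃ N : Matrix (Fin pb.dim) (Fin pb.dim) (MvPolynomial σ K),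
      ∀ (f : L) (δ ν : MvPolynomial σ K) (a : Fin pb.dim → MvPolynomial σ K),
        (∀ l, algebraMap _ k (a l) = algebraMap _ k δ * pb.basis.repr f l) →
        algebraMap _ k ν = Algebra.norm k f →
        δ ^ pb.dim * ν = (∑ l, a l • N ^ (l : ℕ)).det := by
  haveI := faithful_of_frac K L k σ
  have hmin := minpoly.isIntegrallyClosed_eq_field_fractions' k hz
  let N : Matrix (Fin pb.dim) (Fin pb.dim) (MvPolynomial σ K) := Matrix.of fun i j =>
      if (j : ℕ) + 1 = pb.dim then -(minpoly (MvPolynomial σ K) pb.gen).coeff ↑i else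
        if (i : ℕ) = j + 1 then 1 else 0
  have hN : (algebraMap (MvPolynomial σ K) k).mapMatrix N = Algebra.leftMulMatrix pb.basis pb.gen := by
    rw [pb.leftMulMatrix, pb.minpolyGen_eq, hmin]
    ext i j
    simp only [N, RingHom.mapMatrix_apply, Matrix.map_apply, Matrix.of_apply, Polynomial.coeff_map]
    split_ifs <;> simp
  refine ⟨N, fun f δ ν a ha hν => ?_⟩
  apply IsFractionRing.injective (MvPolynomial σ K) k
  rw [map_mul, map_pow, hν, RingHom.map_det, map_sum]
  have h1 : algebraMap _ k δ ^ pb.dim * Algebra.norm k f =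
      Algebra.norm k (algebraMap k L (algebraMap _ k δ) * f) := by
    rw [map_mul, Algebra.norm_algebraMap, pb.finrank]
  have h2 : algebraMap k L (algebraMap _ k δ) * f =
      ∑ l : Fin pb.dim, algebraMap k L (algebraMap _ k (a l)) * pb.gen ^ (l : ℕ) := by
    conv_lhs => rw [← pb.basis.sum_repr f]
    rw [Finset.mul_sum]
    refine Finset.sum_congr rfl fun l _ => ?_
    rw [ha, map_mul, Algebra.smul_def, pb.basis_eq_pow]
    ring
  rw [h1, h2, Algebra.norm_eq_matrix_det pb.basis, map_sum]
  congr 1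
  refine Finset.sum_congr rfl fun l _ => ?_
  rw [map_mul, map_pow, ← hN, AlgHom.commutes, ← map_pow]
  ext i j
  simp [Algebra.algebraMap_eq_smul_one, mul_smul]

end norm

section line
variable {K : Type*} [Field K] {σ : Type*} [Fintype σ]

/-- restriction to the line through `y0` with direction `w` -/
noncomputable def line (y0 w : σ → K) : MvPolynomial σ K →ₐ[K] Polynomial K :=
  aeval fun i => Polynomial.C (y0 i) + Polynomial.C (w i) * Polynomial.X

/-- translation by `y0` -/
noncomputable def shift (y0 : σ → K) : MvPolynomial σ K →ₐ[K] MvPolynomial σ K :=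
  aeval fun i => C (y0 i) + X i

theorem line_shift (y0 w : σ → K) (a : MvPolynomial σ K) :
    line y0 w a = aeval (fun i => Polynomial.C (w i) * Polynomial.X) (shift y0 a) := by
  have : line y0 w = (aeval (fun i => Polynomial.C (w i) * Polynomial.X)).comp (shift y0) := by
    apply MvPolynomial.algHom_ext
    intro i
    simp [line, shift]
  rw [this]; rfl

theorem line_dvd (y0 w : σ → K) (a : MvPolynomial σ K) (D : ℕ)
    (h : ∀ α : σ →₀ ℕ, ∑ j, α j ≤ D → coeff α (shift y0 a) = 0) :
    Polynomial.X ^ (D + 1) ∣ line y0 w a := by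
  rw [line_shift, (shift y0 a).as_sum, map_sum]
  refine Finset.dvd_sum fun α hα => ?_
  rw [aeval_monomial, Finsupp.prod_fintype _ _ (fun _ => pow_zero _)]
  simp only [mul_pow, Finset.prod_mul_distrib, Finset.prod_pow_eq_pow_sum]
  refine Dvd.dvd.mul_left (Dvd.dvd.mul_left (pow_dvd_pow _ ?_) _) _
  by_contra hlt
  exact mem_support_iff.1 hα (h α (by omega))

theorem line_natDegree (y0 w : σ → K) (a : MvPolynomial σ K) :
    (line y0 w a).natDegree ≤ a.totalDegree := by
  conv_lhs => rw [a.as_sum, map_sum]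
  refine Polynomial.natDegree_sum_le_of_forall_le _ _ fun α hα => ?_
  rw [line, aeval_monomial, Finsupp.prod_fintype _ _ (fun _ => pow_zero _)]
  refine (Polynomial.natDegree_C_mul_le _ _).trans ?_
  refine (prod_lin Finset.univ y0 w α).1.trans (degree_le_of_mem le_rfl hα)

theorem line_eval (y0 w : σ → K) (a : MvPolynomial σ K) (t : K) :
    (line y0 w a).eval t = eval (fun i => y0 i + w i * t) a := by
  have : (Polynomial.aeval t).comp (line y0 w) = aeval (fun i => y0 i + w i * t) := by
    apply MvPolynomial.algHom_ext
    intro i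
    simp [line]
  have := congrArg (fun φ => φ a) this
  exact this

end line

section hilbert
variable {K L k : Type*} [Field K] [Infinite K] [Field L] [Field k] [Algebra K L]
  {r : ℕ} [Algebra (MvPolynomial (Fin r) K) L] [IsScalarTower K (MvPolynomial (Fin r) K) L]
  [Algebra (MvPolynomial (Fin r) K) k] [IsFractionRing (MvPolynomial (Fin r) K) k] [Algebra k L]
  [IsScalarTower (MvPolynomial (Fin r) K) k L] [FiniteDimensional k L]

theorem exists_eval_ne_zero {σ : Type*} (a : MvPolynomial σ K) (ha : a ≠ 0) :
    ∃ y0 : σ → K, eval y0 a ≠ 0 := by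
  by_contra! h
  exact ha (MvPolynomial.funext fun x => by rw [h x, map_zero])

theorem hilbert (pb : PowerBasis k L) (hz : IsIntegral (MvPolynomial (Fin r) K) pb.gen)
    (T : Finset L) (D : ℕ) :
    ∃ Λ : L →ₗ[K] (Fin pb.dim × expo r D → K), ∀ f ∈ Submodule.span K (T : Set L),
      Wt K (fun i : Fin r => algebraMap (MvPolynomial (Fin r) K) L (X i)) D f → Λ f = 0 → f = 0 := by
  classical
  letI : Algebra K k := ((algebraMap (MvPolynomial (Fin r) K) k).comp C).toAlgebra
  haveI : IsScalarTower K (MvPolynomial (Fin r) K) k := IsScalarTower.of_algebraMap_eq' rfl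
  haveI : IsScalarTower K k L := IsScalarTower.of_algebraMap_eq fun c => by
    rw [IsScalarTower.algebraMap_apply K (MvPolynomial (Fin r) K) L,
      IsScalarTower.algebraMap_apply K (MvPolynomial (Fin r) K) k,
      ← IsScalarTower.algebraMap_apply (MvPolynomial (Fin r) K) k L]
  obtain ⟨π, hπ⟩ := LinearMap.exists_leftInverse_of_injective
    (IsScalarTower.toAlgHom K (MvPolynomial (Fin r) K) k).toLinearMap
    (LinearMap.ker_eq_bot.2 (IsFractionRing.injective (MvPolynomial (Fin r) K) k))
  have hπ' : ∀ a : MvPolynomial (Fin r) K, π (algebraMap _ k a) = a := fun a =>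
    congrArg (fun φ => φ a) hπ
  obtain ⟨⟨δ, hδ⟩, hδT⟩ := IsLocalization.exist_integer_multiples_of_finset
    (nonZeroDivisors (MvPolynomial (Fin r) K))
    ((T ×ˢ (Finset.univ : Finset (Fin pb.dim))).image fun p => pb.basis.repr p.1 p.2)
  have hδ0 : δ ≠ 0 := nonZeroDivisors.ne_zero hδ
  obtain ⟨y0, hy0⟩ := exists_eval_ne_zero δ hδ0
  have hspan : ∀ f ∈ Submodule.span K (T : Set L), ∀ l, ∃ a : MvPolynomial (Fin r) K,
      algebraMap _ k a = algebraMap _ k δ * pb.basis.repr f l := by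
    intro f hf l
    induction hf using Submodule.span_induction with
    | mem x hx =>
      obtain ⟨a, ha⟩ := hδT (pb.basis.repr x l) (Finset.mem_image.2 ⟨(x, l), by simpa using hx, rfl⟩)
      exact ⟨a, by rw [ha]; rw [Algebra.smul_def]⟩
    | zero => exact ⟨0, by simp⟩
    | add x y _ _ hx hy =>
      obtain ⟨a, ha⟩ := hx
      obtain ⟨b, hb⟩ := hy
      exact ⟨a + b, by simp [ha, hb, mul_add]⟩
    | smul c x _ hx =>
      obtain ⟨a, ha⟩ := hx
      refine ⟨c • a, ?_⟩
      have e : pb.basis.repr (c • x) = (algebraMap K k c) • pb.basis.repr x := by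
        rw [← map_smul, algebraMap_smul]
      rw [e, Finsupp.smul_apply, smul_eq_mul, Algebra.smul_def, map_mul, ha,
        ← IsScalarTower.algebraMap_apply]
      ring
  let Λ : L →ₗ[K] (Fin pb.dim × expo r D → K) := LinearMap.pi fun p =>
    (lcoeff K p.2.1) ∘ₗ (shift y0).toLinearMap ∘ₗ π ∘ₗ
      (LinearMap.mulLeft K (algebraMap (MvPolynomial (Fin r) K) k δ)) ∘ₗ
      ((pb.basis.coord p.1).restrictScalars K)
  obtain ⟨N, hN⟩ := exists_matrix (K := K) (σ := Fin r) pb hz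
  refine ⟨Λ, fun f hf hW h0 => ?_⟩
  by_contra hf0
  obtain ⟨ν, hν0, hνd, hν⟩ := exists_norm (k := k) f hf0 D hW
  choose a ha using hspan f hf
  have hdet := hN f δ ν a ha hν
  obtain ⟨w, hw⟩ := exists_eval_ne_zero ν hν0
  let φ := line y0 (fun i => w i - y0 i)
  have hdiv : ∀ l, Polynomial.X ^ (D + 1) ∣ φ (a l) := by
    intro l
    refine line_dvd _ _ _ _ fun α hα => ?_
    have := congrFun h0 (l, ⟨α, mem_expo.2 hα⟩)
    have e : Λ f (l, ⟨α, mem_expo.2 hα⟩) = coeff α (shift y0 (π (algebraMap _ k δ *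
      pb.basis.repr f l))) := rfl
    rw [e, ← ha, hπ'] at this
    exact this
  have hdvd : Polynomial.X ^ ((D + 1) * pb.dim) ∣ φ δ ^ pb.dim * φ ν := by
    rw [← map_pow, ← map_mul, hdet]
    have e : φ (∑ l, a l • N ^ (l : ℕ)).det = (φ.toRingHom.mapMatrix (∑ l, a l • N ^ (l : ℕ))).det :=
      RingHom.map_det φ.toRingHom _
    rw [e]
    choose b hb using hdiv
    have e2 : φ.toRingHom.mapMatrix (∑ l, a l • N ^ (l : ℕ)) = (Polynomial.X ^ (D + 1) : Polynomial K) •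
        ∑ l, b l • (φ.toRingHom.mapMatrix (N ^ (l : ℕ))) := by
      rw [map_sum, Finset.smul_sum]
      refine Finset.sum_congr rfl fun l _ => ?_
      rw [smul_smul, ← hb]
      ext i j : 2
      simp
    rw [e2, Matrix.det_smul, Fintype.card_fin, ← pow_mul]
    exact dvd_mul_right _ _
  have hcop : IsCoprime (Polynomial.X ^ ((D + 1) * pb.dim)) (φ δ ^ pb.dim) := by
    apply IsCoprime.pow
    rw [(Polynomial.prime_X).coprime_iff_not_dvd, Polynomial.X_dvd_iff,
      Polynomial.coeff_zero_eq_eval_zero, line_eval]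
    simpa using hy0
  have hdvd2 := hcop.dvd_of_dvd_mul_left hdvd
  have hne : φ ν ≠ 0 := by
    intro h
    have := line_eval y0 (fun i => w i - y0 i) ν 1
    change Polynomial.eval 1 (φ ν) = _ at this
    rw [h] at this
    simp only [mul_one, add_sub_cancel, Polynomial.eval_zero] at this
    exact hw this.symm
  have h1 := Polynomial.natDegree_le_of_dvd hdvd2 hne
  rw [Polynomial.natDegree_X_pow] at h1
  have h2 : (φ ν).natDegree ≤ pb.dim * D := by
    refine (line_natDegree _ _ _).trans ?_
    rwa [pb.finrank] at hνd
  have h3 := pb.dim_pos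
  nlinarith

end hilbert
end RSV


namespace RSV
set_option linter.all false
set_option linter.unusedSectionVars false
set_option linter.unusedSimpArgs false
set_option linter.style.haveILetI false

section lo
variable {K L : Type*} [Field K] [IsAlgClosed K] [Field L] [Algebra K L]
  {σ : Type*} [Algebra (MvPolynomial σ K) L] [IsScalarTower K (MvPolynomial σ K) L]
  [FaithfulSMul (MvPolynomial σ K) L]

theorem lying_over {ι : Type*} (x : ι → L) (hx : ∀ j, IsIntegral (MvPolynomial σ K) (x j))
    (z : L) (hz : IsIntegral (MvPolynomial σ K) z) (y0 : σ → K) (ζ : K)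
    (hζ : (minpoly (MvPolynomial σ K) z).eval₂ (eval y0) ζ = 0) :
    ∃ w : ι → K, (∀ (h : MvPolynomial ι K) (a : MvPolynomial σ K),
      aeval x h = algebraMap _ L a → eval w h = eval y0 a) ∧
      (∀ h : MvPolynomial ι K, aeval x h = z → eval w h = ζ) := by
  let A := MvPolynomial σ K
  let B := integralClosure A L
  let z' : B := ⟨z, hz⟩
  letI alg : Algebra (Polynomial A) B := (Polynomial.aeval z').toAlgebra
  haveI : IsScalarTower A (Polynomial A) B := IsScalarTower.of_algebraMap_eq fun a => by
    change _ = Polynomial.aeval z' (Polynomial.C a)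
    rw [Polynomial.aeval_C]
  haveI : Algebra.IsIntegral A B := inferInstance
  haveI : Algebra.IsIntegral (Polynomial A) B := Algebra.IsIntegral.tower_top (R := A)
  let φ : Polynomial A →+* K := Polynomial.eval₂RingHom (eval y0) ζ
  let M := RingHom.ker φ
  haveI : M.IsPrime := RingHom.ker_isPrime _
  obtain ⟨Q, -, hQ, hQM⟩ := Ideal.exists_ideal_over_prime_of_isIntegral M (⊥ : Ideal B) (by
    intro p hp
    have h1 : Polynomial.aeval z' p = 0 := hp
    have h2 : Polynomial.aeval z p = 0 := by
      have := congrArg (B.val) h1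
      rw [← Polynomial.aeval_algHom_apply] at this
      simpa [z'] using this
    obtain ⟨q, rfl⟩ := minpoly.isIntegrallyClosed_dvd hz h2
    rw [RingHom.mem_ker, map_mul]
    change (minpoly (MvPolynomial σ K) z).eval₂ (eval y0) ζ * _ = 0
    rw [hζ, zero_mul])
  have hφC : ∀ a : A, φ (Polynomial.C a) = eval y0 a := fun a => by
    change Polynomial.eval₂ _ _ _ = _
    rw [Polynomial.eval₂_C]
  have hKB : ∀ c : K, algebraMap K (B ⧸ Q) c = Ideal.Quotient.mk Q (algebraMap A B (C c)) := by
    intro c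
    rw [IsScalarTower.algebraMap_apply K B (B ⧸ Q), IsScalarTower.algebraMap_apply K A B]
    rfl
  have key : ∀ p : Polynomial A, Ideal.Quotient.mk Q (Polynomial.aeval z' p) =
      algebraMap K (B ⧸ Q) (φ p) := by
    intro p
    have h1 : p - Polynomial.C (C (φ p)) ∈ M := by
      rw [RingHom.mem_ker, map_sub, hφC, eval_C, sub_self]
    rw [← hQM, Ideal.mem_comap] at h1
    change Polynomial.aeval z' _ ∈ Q at h1
    rw [map_sub, ← Ideal.Quotient.eq, Polynomial.aeval_C] at h1
    rw [h1, hKB]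
  haveI : Algebra.IsIntegral K (B ⧸ Q) := by
    constructor
    intro b
    obtain ⟨b, rfl⟩ := Ideal.Quotient.mk_surjective b
    obtain ⟨p, hp, hpb⟩ := Algebra.IsIntegral.isIntegral (R := A) b
    refine ⟨p.map (eval y0), hp.map _, ?_⟩
    rw [Polynomial.eval₂_map]
    have h2 : (algebraMap K (B ⧸ Q)).comp (eval y0) = (Ideal.Quotient.mk Q).comp (algebraMap A B) := by
      ext a
      · have := key (Polynomial.C (C a))
        rw [Polynomial.aeval_C] at this
        simp only [RingHom.comp_apply]
        rw [this, hφC]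
      · have := key (Polynomial.C (X a))
        rw [Polynomial.aeval_C] at this
        simp only [RingHom.comp_apply]
        rw [this, hφC]
    rw [h2, ← Polynomial.hom_eval₂, hpb, map_zero]
  have hbij := IsAlgClosed.algebraMap_bijective_of_isIntegral (k := K) (K := B ⧸ Q)
  choose w hw using fun j => hbij.2 (Ideal.Quotient.mk Q (⟨x j, hx j⟩ : B))
  have hev : ∀ (h : MvPolynomial ι K), algebraMap K (B ⧸ Q) (eval w h) =
      Ideal.Quotient.mk Q (aeval (fun j => (⟨x j, hx j⟩ : B)) h) := by
    intro h
    have e : (Algebra.ofId K (B ⧸ Q)).comp (aeval w) = (Ideal.Quotient.mkₐ K Q).comp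
        (aeval (fun j => (⟨x j, hx j⟩ : B))) := by
      apply MvPolynomial.algHom_ext
      intro j
      simp [Algebra.ofId_apply, hw]
    exact congrArg (fun f => f h) e
  have hval : ∀ (h : MvPolynomial ι K), ((aeval (fun j => (⟨x j, hx j⟩ : B)) h : B) : L) = aeval x h := by
    intro h
    have e : (B.val.restrictScalars K).comp (aeval (fun j => (⟨x j, hx j⟩ : B))) = aeval x := by
      apply MvPolynomial.algHom_ext
      intro j
      simp
    exact congrArg (fun f => f h) e
  refine ⟨w, fun h a ha => ?_, fun h ha => ?_⟩
  · apply hbij.1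
    have e : (aeval (fun j => (⟨x j, hx j⟩ : B)) h : B) = Polynomial.aeval z' (Polynomial.C a) := by
      apply Subtype.ext
      rw [hval, ha, Polynomial.aeval_C]
      rfl
    rw [hev, e, key, hφC]
  · apply hbij.1
    have e : (aeval (fun j => (⟨x j, hx j⟩ : B)) h : B) = Polynomial.aeval z' (Polynomial.X : Polynomial A) := by
      apply Subtype.ext
      rw [hval, ha, Polynomial.aeval_X]
    rw [hev, e, key]
    congr 1
    exact Polynomial.eval₂_X _ _

end lo
end RSV


namespace RSV
set_option linter.all false
set_option linter.unusedSectionVars false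
set_option linter.unusedSimpArgs false
set_option linter.style.haveILetI false

theorem separating {K : Type*} [Field K] [Infinite K] {n : ℕ} (Z : Finset (Fin n → K))
    (h0 : (0 : Fin n → K) ∉ Z) : ∃ c : Fin n → K, ∀ v ∈ Z, ∑ j, c j * v j ≠ 0 := by
  have hne : (∏ v ∈ Z, ∑ j, C (v j) * X j : MvPolynomial (Fin n) K) ≠ 0 := by
    rw [Finset.prod_ne_zero_iff]
    intro v hv h
    apply h0
    have : v = 0 := by
      funext j
      have := congrArg (eval (Pi.single j 1)) h
      simpa [Pi.single_apply] using this
    rwa [this] at hv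
  obtain ⟨c, hc⟩ := exists_eval_ne_zero _ hne
  refine ⟨c, fun v hv h => hc ?_⟩
  rw [map_prod]
  refine Finset.prod_eq_zero hv ?_
  rw [← h]
  simp [mul_comm]

/-- linear form -/
noncomputable def lin {K : Type*} [Field K] {n : ℕ} (c : Fin n → K) : MvPolynomial (Fin n) K :=
  ∑ j, C (c j) * X j

theorem lin_eval {K : Type*} [Field K] {n : ℕ} (c w : Fin n → K) :
    eval w (lin c) = ∑ j, c j * w j := by simp [lin]

theorem lin_aeval {K L : Type*} [Field K] [Field L] [Algebra K L] {n : ℕ} (c : Fin n → K)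
    (x : Fin n → L) : aeval x (lin c) = ∑ j, c j • x j := by simp [lin, Algebra.smul_def]

theorem lin_deg {K : Type*} [Field K] {n : ℕ} (c : Fin n → K) : (lin c).totalDegree ≤ 1 := by
  refine totalDegree_finsetSum_le fun j _ => ?_
  refine (totalDegree_mul _ _).trans ?_
  simp

theorem aeval_deg {K : Type*} [Field K] {σ τ : Type*} [Fintype σ] (l : σ → MvPolynomial τ K) (q : ℕ)
    (hl : ∀ i, (l i).totalDegree ≤ q) (a : MvPolynomial σ K) :
    (aeval l a).totalDegree ≤ q * a.totalDegree := by
  conv_lhs => rw [a.as_sum, map_sum]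
  refine totalDegree_finsetSum_le fun α hα => ?_
  rw [aeval_monomial, Finsupp.prod_fintype _ _ (fun _ => pow_zero _)]
  refine (totalDegree_mul _ _).trans ?_
  rw [algebraMap_eq, totalDegree_C, zero_add]
  refine (totalDegree_finset_prod _ _).trans ?_
  refine (Finset.sum_le_sum fun i _ => (totalDegree_pow _ _).trans
    (Nat.mul_le_mul_left _ (hl i))).trans ?_
  rw [← Finset.sum_mul, mul_comm]
  exact Nat.mul_le_mul_left _ (degree_le_of_mem le_rfl hα)

/-- points of the variety -/
def Pt {K L : Type*} [Field K] [Field L] [Algebra K L] {n : ℕ} (x : Fin n → L) (w : Fin n → K) : Prop :=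
  ∀ h : MvPolynomial (Fin n) K, aeval x h = 0 → eval w h = 0

section fib
variable {K L : Type*} [Field K] [IsAlgClosed K] [Field L] [Algebra K L]
  {r n : ℕ} [Algebra (MvPolynomial (Fin r) K) L] [IsScalarTower K (MvPolynomial (Fin r) K) L]
  [FaithfulSMul (MvPolynomial (Fin r) K) L]
  (x : Fin n → L) (l : Fin r → MvPolynomial (Fin n) K)
  (hl : ∀ i, algebraMap (MvPolynomial (Fin r) K) L (X i) = aeval x (l i))
  (hx : ∀ j, IsIntegral (MvPolynomial (Fin r) K) (x j))

include hl in
theorem aeval_l (a : MvPolynomial (Fin r) K) : aeval x (aeval l a) = algebraMap _ L a := by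
  have e : (aeval x).comp (aeval l) = IsScalarTower.toAlgHom K (MvPolynomial (Fin r) K) L := by
    apply MvPolynomial.algHom_ext
    intro i
    simp [hl]
  exact congrArg (fun f => f a) e

theorem eval_l (w : Fin n → K) (a : MvPolynomial (Fin r) K) :
    eval w (aeval l a) = eval (fun i => eval w (l i)) a := by
  have e : (aeval w).comp (aeval l) = (aeval (fun i => eval w (l i)) : _ →ₐ[K] K) := by
    apply MvPolynomial.algHom_ext
    intro i
    simp [coe_aeval_eq_eval]
  exact congrArg (fun f => f a) e

include hl in
theorem fib_eval (w : Fin n → K) (hw : Pt x w) (h : MvPolynomial (Fin n) K)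
    (a : MvPolynomial (Fin r) K) (ha : aeval x h = algebraMap _ L a) :
    eval w h = eval (fun i => eval w (l i)) a := by
  have := hw (h - aeval l a) (by rw [map_sub, aeval_l x l hl, ha, sub_self])
  rw [map_sub, eval_l, sub_eq_zero] at this
  exact this

/-- the polynomial `P(l, λ)` -/
noncomputable def subst (P : Polynomial (MvPolynomial (Fin r) K)) (g : MvPolynomial (Fin n) K) :
    MvPolynomial (Fin n) K := P.eval₂ (aeval l : _ →ₐ[K] MvPolynomial (Fin n) K).toRingHom g

include hl in
theorem subst_aeval (P : Polynomial (MvPolynomial (Fin r) K)) (g : MvPolynomial (Fin n) K) :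
    aeval x (subst l P g) = Polynomial.aeval (aeval x g) P := by
  have := Polynomial.hom_eval₂ P (aeval l : _ →ₐ[K] MvPolynomial (Fin n) K).toRingHom
    (aeval x : _ →ₐ[K] L).toRingHom g
  refine this.trans ?_
  rw [Polynomial.aeval_def]
  congr 1
  apply MvPolynomial.ringHom_ext
  · intro a
    simpa using (IsScalarTower.algebraMap_apply K (MvPolynomial (Fin r) K) L a)
  · intro i
    simp [hl]

theorem subst_eval (w : Fin n → K) (P : Polynomial (MvPolynomial (Fin r) K)) (g : MvPolynomial (Fin n) K) :
    eval w (subst l P g) = P.eval₂ (eval fun i => eval w (l i)) (eval w g) := by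
  have := Polynomial.hom_eval₂ P (aeval l : _ →ₐ[K] MvPolynomial (Fin n) K).toRingHom
    (eval w) g
  refine this.trans ?_
  congr 1
  apply MvPolynomial.ringHom_ext
  · intro a
    simp
  · intro i
    simp

include hl in
theorem root_of_pt (w : Fin n → K) (hw : Pt x w) (g : MvPolynomial (Fin n) K) :
    (minpoly (MvPolynomial (Fin r) K) (aeval x g)).eval₂ (eval fun i => eval w (l i)) (eval w g) = 0 := by
  rw [← subst_eval]
  apply hw
  rw [subst_aeval x l hl, minpoly.aeval]

include hl hx in
theorem fib_finite (y0 : Fin r → K) : {w | Pt x w ∧ ∀ i, eval w (l i) = y0 i}.Finite := by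
  classical
  have : {w | Pt x w ∧ ∀ i, eval w (l i) = y0 i} ⊆ Set.pi Set.univ (fun j =>
      (((minpoly (MvPolynomial (Fin r) K) (x j)).map (eval y0)).roots.toFinset : Set K)) := by
    rintro w ⟨hw, hw2⟩ j -
    have h1 := root_of_pt x l hl w hw (X j)
    rw [aeval_X, eval_X, funext hw2] at h1
    simp only [Finset.mem_coe, Multiset.mem_toFinset]
    rw [Polynomial.mem_roots ((minpoly.monic (hx j)).map _).ne_zero, Polynomial.IsRoot,
      Polynomial.eval_map]
    exact h1
  exact (Set.Finite.pi' fun j => Finset.finite_toSet _).subset (fun w hw j => this hw j trivial)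

end fib

section core
variable {K L k : Type*} [Field K] [IsAlgClosed K] [Field L] [Field k] [Algebra K L]
  {r n : ℕ} [Algebra (MvPolynomial (Fin r) K) L] [IsScalarTower K (MvPolynomial (Fin r) K) L]
  [Algebra (MvPolynomial (Fin r) K) k] [IsFractionRing (MvPolynomial (Fin r) K) k] [Algebra k L]
  [IsScalarTower (MvPolynomial (Fin r) K) k L] [FiniteDimensional k L]
  [FaithfulSMul (MvPolynomial (Fin r) K) L]
  (x : Fin n → L) (l : Fin r → MvPolynomial (Fin n) K)
  (hl : ∀ i, algebraMap (MvPolynomial (Fin r) K) L (X i) = aeval x (l i))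
  (hl1 : ∀ i, (l i).totalDegree ≤ 1)
  (hx : ∀ j, Wt K (fun i : Fin r => algebraMap (MvPolynomial (Fin r) K) L (X i)) 1 (x j))

include hx in
theorem int_of_wt (j) : IsIntegral (MvPolynomial (Fin r) K) (x j) := (wt_minpoly _ _ (hx j)).1

include hx in
theorem int_aeval (g : MvPolynomial (Fin n) K) : IsIntegral (MvPolynomial (Fin r) K) (aeval x g) :=
  (wt_minpoly _ _ (wt_aeval _ x hx g.totalDegree g le_rfl)).1

include hl hl1 hx in
theorem separation (p : Fin n → K) (hp : ¬ Pt x p) :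
    ∃ G : MvPolynomial (Fin n) K, aeval x G = 0 ∧ G.totalDegree ≤ Module.finrank k L ∧ eval p G ≠ 0 := by
  classical
  have hfin := fib_finite x l hl (int_of_wt x hx) (fun i => eval p (l i))
  obtain ⟨c, hc⟩ := separating (hfin.toFinset.image fun w => p - w) (by
    rw [Finset.mem_image]
    rintro ⟨w, hw, h⟩
    rw [Set.Finite.mem_toFinset] at hw
    rw [sub_eq_zero] at h
    rw [h] at hp
    exact hp hw.1)
  let z := aeval x (lin c)
  have hzw := wt_aeval _ x hx 1 (lin c) (lin_deg c)
  obtain ⟨hz, hdeg⟩ := wt_minpoly _ _ hzw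
  let μ := minpoly (MvPolynomial (Fin r) K) z
  refine ⟨subst l μ (lin c), ?_, ?_, ?_⟩
  · rw [subst_aeval x l hl, minpoly.aeval]
  · have h1 : μ.natDegree ≤ Module.finrank k L := by
      have h2 := minpoly.isIntegrallyClosed_eq_field_fractions' k hz
      have h3 := minpoly.natDegree_le (A := k) z
      rw [h2, (minpoly.monic hz).natDegree_map] at h3
      exact h3
    refine le_trans ?_ h1
    rw [subst, Polynomial.eval₂_eq_sum_range]
    refine totalDegree_finsetSum_le fun i hi => ?_
    refine (totalDegree_mul _ _).trans ?_
    have h2 := hdeg i (by simpa [Nat.lt_succ_iff] using hi)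
    have h3 := aeval_deg l 1 hl1 (μ.coeff i)
    have h4 := (totalDegree_pow (lin c) i).trans (Nat.mul_le_mul_left i (lin_deg c))
    have h5 : i ≤ μ.natDegree := by simpa [Nat.lt_succ_iff] using hi
    change (aeval l (μ.coeff i)).totalDegree + _ ≤ _
    change (μ.coeff i).totalDegree ≤ (μ.natDegree - i) * 1 at h2
    omega
  · intro h
    rw [subst_eval] at h
    obtain ⟨w, hw, hwz⟩ := lying_over x (int_of_wt x hx) z hz _ _ h
    have hw1 : w ∈ hfin.toFinset := by
      rw [Set.Finite.mem_toFinset]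
      refine ⟨fun f hf => ?_, fun i => ?_⟩
      · have := hw f 0 (by rw [hf, map_zero])
        simpa using this
      · have := hw (l i) (X i) (hl i).symm
        simpa using this
    have h2 := hwz (lin c) rfl
    apply hc (p - w) (Finset.mem_image_of_mem _ hw1)
    simp only [Pi.sub_apply, mul_sub, Finset.sum_sub_distrib]
    rw [← lin_eval, ← lin_eval, h2, sub_self]

include hx in
theorem hilbert_poly (pb : PowerBasis k L) (hz : IsIntegral (MvPolynomial (Fin r) K) pb.gen) (D : ℕ) :
    ∃ Λ : MvPolynomial (Fin n) K →ₗ[K] (Fin (Module.finrank k L * (D + r).choose r) → K),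
      ∀ f, f.totalDegree ≤ D → Λ f = 0 → aeval x f = 0 := by
  classical
  obtain ⟨Λ, hΛ⟩ := hilbert pb hz ((expo n D).image fun α => aeval x (monomial α (1 : K))) D
  have hcard : Fintype.card (Fin pb.dim × expo r D) = Module.finrank k L * (D + r).choose r := by
    rw [Fintype.card_prod, Fintype.card_fin, Fintype.card_coe, card_expo, pb.finrank]
  let e := Fintype.equivFinOfCardEq hcard
  refine ⟨(LinearMap.funLeft K K e.symm) ∘ₗ Λ ∘ₗ (aeval x).toLinearMap, fun f hf h0 => ?_⟩
  apply hΛ _ _ (wt_aeval _ x hx D f hf)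
  · funext i
    have := congrFun h0 (e i)
    simpa [LinearMap.funLeft_apply] using this
  · rw [f.as_sum, map_sum]
    refine Submodule.sum_mem _ fun α hα => ?_
    have : monomial α (coeff α f) = coeff α f • monomial α (1 : K) := by simp [smul_monomial]
    rw [this, map_smul]
    refine Submodule.smul_mem _ _ (Submodule.subset_span ?_)
    rw [Finset.mem_coe]
    exact Finset.mem_image_of_mem _ (mem_expo.2 (degree_le_of_mem hf hα))

include hl hx in
theorem many_points [Algebra.IsSeparable k L] (pb : PowerBasis k L) (g : MvPolynomial (Fin n) K)
    (hg : pb.gen = aeval x g) :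
    ∃ y0 : Fin r → K, Module.finrank k L ≤ {w | Pt x w ∧ ∀ i, eval w (l i) = y0 i}.ncard := by
  classical
  have hz : IsIntegral (MvPolynomial (Fin r) K) pb.gen := by rw [hg]; exact int_aeval x hx g
  let μ := minpoly (MvPolynomial (Fin r) K) pb.gen
  have hmin := minpoly.isIntegrallyClosed_eq_field_fractions' k hz
  have hsep : (minpoly k pb.gen).Separable := Algebra.IsSeparable.isSeparable k pb.gen
  rw [hmin] at hsep
  have hinj := IsFractionRing.injective (MvPolynomial (Fin r) K) k
  -- discriminant
  obtain ⟨δ, hδ, a, b, hab⟩ : ∃ δ : MvPolynomial (Fin r) K, δ ≠ 0 ∧ ∃ a b : Polynomial (MvPolynomial (Fin r) K),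
      a * μ + b * Polynomial.derivative μ = Polynomial.C δ := by
    obtain ⟨a, b, hab⟩ := hsep
    obtain ⟨δ1, h1, ha⟩ := IsLocalization.integerNormalization_spec
      (nonZeroDivisors (MvPolynomial (Fin r) K)) a
    obtain ⟨δ2, h2, hb⟩ := IsLocalization.integerNormalization_spec
      (nonZeroDivisors (MvPolynomial (Fin r) K)) b
    refine ⟨δ1 * δ2, mul_ne_zero (nonZeroDivisors.ne_zero h1) (nonZeroDivisors.ne_zero h2),
      Polynomial.C δ2 * IsLocalization.integerNormalization (nonZeroDivisors (MvPolynomial (Fin r) K)) a,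
      Polynomial.C δ1 * IsLocalization.integerNormalization (nonZeroDivisors (MvPolynomial (Fin r) K)) b, ?_⟩
    apply Polynomial.map_injective _ hinj
    rw [Polynomial.map_add, Polynomial.map_mul, Polynomial.map_mul, Polynomial.map_mul,
      Polynomial.map_mul, Polynomial.map_C, Polynomial.map_C, Polynomial.map_C, ha, hb,
      ← Polynomial.derivative_map, Algebra.smul_def, Algebra.smul_def, map_mul, Polynomial.C_mul,
      Polynomial.algebraMap_apply, Polynomial.algebraMap_apply]
    linear_combination (Polynomial.C (algebraMap (MvPolynomial (Fin r) K) k δ1) *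
      Polynomial.C (algebraMap (MvPolynomial (Fin r) K) k δ2)) * hab
  obtain ⟨y0, hy0⟩ := exists_eval_ne_zero _ hδ
  refine ⟨y0, ?_⟩
  have hroots : ((μ.map (eval y0)).roots.toFinset).card = Module.finrank k L := by
    have hs : (μ.map (eval y0)).Separable := by
      refine ⟨Polynomial.C (eval y0 δ)⁻¹ * a.map (eval y0), Polynomial.C (eval y0 δ)⁻¹ * b.map (eval y0), ?_⟩
      have h1 := congrArg (Polynomial.map (eval y0)) hab
      rw [Polynomial.map_add, Polynomial.map_mul, Polynomial.map_mul, Polynomial.map_C,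
        ← Polynomial.derivative_map] at h1
      rw [mul_assoc, mul_assoc, ← mul_add, h1, ← Polynomial.C_mul, inv_mul_cancel₀ hy0, Polynomial.C_1]
    rw [Multiset.toFinset_card_of_nodup (Polynomial.nodup_roots hs),
      IsAlgClosed.card_roots_eq_natDegree, (minpoly.monic hz).natDegree_map, pb.finrank,
      ← pb.natDegree_minpoly, hmin, (minpoly.monic hz).natDegree_map]
  rw [← hroots]
  have hfin := fib_finite x l hl (int_of_wt x hx) y0
  have himg : ((μ.map (eval y0)).roots.toFinset : Set K) ⊆
      (fun w => eval w g) '' {w | Pt x w ∧ ∀ i, eval w (l i) = y0 i} := by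
    intro ζ hζ
    rw [Finset.mem_coe, Multiset.mem_toFinset, Polynomial.mem_roots ((minpoly.monic hz).map _).ne_zero,
      Polynomial.IsRoot, Polynomial.eval_map] at hζ
    obtain ⟨w, hw, hwz⟩ := lying_over x (int_of_wt x hx) pb.gen hz _ _ hζ
    refine ⟨w, ⟨fun f hf => ?_, fun i => ?_⟩, hwz g hg.symm⟩
    · have := hw f 0 (by rw [hf, map_zero])
      simpa using this
    · have := hw (l i) (X i) (hl i).symm
      simpa using this
  rw [← Set.ncard_coe_finset]
  exact (Set.ncard_le_ncard himg (hfin.image _)).trans (Set.ncard_image_le hfin)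

end core
end RSV


namespace RSV
set_option linter.all false
set_option linter.unusedSectionVars false
set_option linter.unusedSimpArgs false
set_option linter.style.haveILetI false

theorem asymp (m ρ q r : ℕ) (h : ∀ M : ℕ, m * (M + r).choose r ≤ ρ * (m + q * M + r).choose r) :
    m ≤ ρ * q ^ r := by
  have h1 : ∀ M : ℕ, 0 < M → (m : ℝ) ≤ ρ * (q + (m + r : ℕ) / (M : ℝ)) ^ r := by
    intro M hM
    have hM' : (0 : ℝ) < M := by exact_mod_cast hM
    have h2 : (M + 1 : ℝ) ^ r ≤ r.factorial * ((M + r).choose r : ℝ) := by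
      have := Nat.pow_le_choose (α := ℝ) r (M + r)
      have e : M + r + 1 - r = M + 1 := by omega
      rw [e] at this
      have hf : (0 : ℝ) < r.factorial := by exact_mod_cast r.factorial_pos
      push_cast at this
      first
      | exact this
      | (rw [div_le_iff₀ hf] at this; linarith)
    have h3 : (r.factorial : ℝ) * ((m + q * M + r).choose r : ℝ) ≤ (m + q * M + r : ℝ) ^ r := by
      have := Nat.choose_le_pow_div (α := ℝ) r (m + q * M + r)
      have hf : (0 : ℝ) < r.factorial := by exact_mod_cast r.factorial_pos
      rw [le_div_iff₀ hf] at this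
      push_cast at this
      linarith
    have h4 : (m : ℝ) * (M + r).choose r ≤ ρ * (m + q * M + r).choose r := by exact_mod_cast h M
    have h5 : (m : ℝ) * M ^ r ≤ ρ * (m + q * M + r : ℝ) ^ r := by
      calc (m : ℝ) * M ^ r ≤ m * (M + 1) ^ r := by gcongr; linarith
        _ ≤ m * (r.factorial * ((M + r).choose r : ℝ)) := by gcongr
        _ = r.factorial * (m * (M + r).choose r) := by ring
        _ ≤ r.factorial * (ρ * (m + q * M + r).choose r) := by gcongr
        _ = ρ * (r.factorial * (m + q * M + r).choose r) := by ring
        _ ≤ _ := by gcongr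
    have e : (q + (m + r : ℕ) / (M : ℝ)) = (m + q * M + r) / M := by
      push_cast
      field_simp
      ring
    rw [e, div_pow, ← mul_div_assoc, le_div_iff₀ (by positivity)]
    exact h5
  have h2 : Filter.Tendsto (fun M : ℕ => (ρ : ℝ) * (q + (m + r : ℕ) / (M : ℝ)) ^ r) Filter.atTop
      (nhds (ρ * (q + 0) ^ r)) := by
    refine Filter.Tendsto.const_mul _ (Filter.Tendsto.pow (Filter.Tendsto.const_add _ ?_) _)
    exact tendsto_const_div_atTop_nhds_zero_nat _
  have h3 : (m : ℝ) ≤ ρ * (q + 0) ^ r := by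
    refine ge_of_tendsto h2 ?_
    filter_upwards [Filter.eventually_gt_atTop 0] with M hM using h1 M hM
  rw [add_zero] at h3
  exact_mod_cast h3

section count
variable {K L : Type*} [Field K] [IsAlgClosed K] [Field L] [Algebra K L]
  {r n : ℕ} [Algebra (MvPolynomial (Fin r) K) L] [IsScalarTower K (MvPolynomial (Fin r) K) L]
  [FaithfulSMul (MvPolynomial (Fin r) K) L]
  (x : Fin n → L) (l : Fin r → MvPolynomial (Fin n) K)
  (hl : ∀ i, algebraMap (MvPolynomial (Fin r) K) L (X i) = aeval x (l i))
  (hx : ∀ j, IsIntegral (MvPolynomial (Fin r) K) (x j))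

theorem sub_deg (q N M : ℕ) (hq : ∀ i, (l i).totalDegree ≤ q) (P : Polynomial (MvPolynomial (Fin r) K))
    (g : MvPolynomial (Fin n) K) (hg : g.totalDegree ≤ 1)
    (hP : P.natDegree ≤ N) (hc : ∀ i, (P.coeff i).totalDegree ≤ M) :
    (subst l P g).totalDegree ≤ N + q * M := by
  rw [subst, Polynomial.eval₂_eq_sum_range]
  refine totalDegree_finsetSum_le fun i hi => ?_
  refine (totalDegree_mul _ _).trans ?_
  have h3 := (aeval_deg l q hq (P.coeff i)).trans (Nat.mul_le_mul_left q (hc i))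
  have h4 := (totalDegree_pow g i).trans (Nat.mul_le_mul_left i hg)
  have h5 : i ≤ P.natDegree := by simpa [Nat.lt_succ_iff] using hi
  change (aeval l (P.coeff i)).totalDegree + _ ≤ _
  omega

include hl hx in
theorem count_ineq (q ρ s : ℕ) (hq : ∀ i, (l i).totalDegree ≤ q)
    (hΛ : ∀ D : ℕ, ∃ Λ : MvPolynomial (Fin n) K →ₗ[K] (Fin (ρ * (D + s).choose s) → K),
      ∀ f, f.totalDegree ≤ D → Λ f = 0 → aeval x f = 0)
    (Y : Finset (Fin n → K)) (hY : ∀ w ∈ Y, Pt x w ∧ ∀ i, eval w (l i) = 0) (hs : s = r) :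
    Y.card ≤ ρ * q ^ r := by
  classical
  subst hs
  obtain ⟨c, hc⟩ := separating ((Y ×ˢ Y).image (fun p => p.1 - p.2) \ {0}) (by simp)
  have hinj : Set.InjOn (fun w => eval w (lin c)) (Y : Set (Fin n → K)) := by
    intro w hw v hv h
    by_contra hne
    apply hc (w - v)
    · rw [Finset.mem_sdiff]
      refine ⟨Finset.mem_image.2 ⟨(w, v), Finset.mem_product.2 ⟨hw, hv⟩, rfl⟩, ?_⟩
      rw [Finset.mem_singleton, sub_eq_zero]
      exact hne
    · simp only [Pi.sub_apply, mul_sub, Finset.sum_sub_distrib]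
      rw [← lin_eval, ← lin_eval]
      exact sub_eq_zero.2 h
  let z := aeval x (lin c)
  have hz : IsIntegral (MvPolynomial (Fin s) K) z := by
    rw [show z = ∑ j, c j • x j from lin_aeval c x]
    refine IsIntegral.sum _ fun j _ => ?_
    rw [Algebra.smul_def, IsScalarTower.algebraMap_apply K (MvPolynomial (Fin s) K) L]
    exact isIntegral_algebraMap.mul (hx j)
  let μ := minpoly (MvPolynomial (Fin s) K) z
  have hYm : Y.card ≤ μ.natDegree := by
    have h1 : Y.image (fun w => eval w (lin c)) ⊆ (μ.map (eval (0 : Fin s → K))).roots.toFinset := by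
      intro ζ hζ
      obtain ⟨w, hw, rfl⟩ := Finset.mem_image.1 hζ
      obtain ⟨hw1, hw2⟩ := hY w hw
      rw [Multiset.mem_toFinset, Polynomial.mem_roots ((minpoly.monic hz).map _).ne_zero,
        Polynomial.IsRoot, Polynomial.eval_map]
      have := root_of_pt x l hl w hw1 (lin c)
      rw [funext hw2] at this
      exact this
    rw [← Finset.card_image_of_injOn hinj, ← (minpoly.monic hz).natDegree_map (eval (0 : Fin s → K))]
    exact (Finset.card_le_card h1).trans ((Multiset.toFinset_card_le _).trans (Polynomial.card_roots' _))
  refine hYm.trans (asymp _ _ _ _ fun M => ?_)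
  obtain ⟨Λ, hΛ⟩ := hΛ (μ.natDegree + q * M)
  -- the polynomial with prescribed coefficients
  let pol : (Fin μ.natDegree × expo s M → K) →ₗ[K] Polynomial (MvPolynomial (Fin s) K) :=
    ∑ p : Fin μ.natDegree × expo s M, (((Polynomial.monomial (R := MvPolynomial (Fin s) K) (p.1 : ℕ)).restrictScalars K) ∘ₗ
      (monomial p.2.1) ∘ₗ (LinearMap.proj p))
  have hpol : ∀ e, pol e = ∑ p : Fin μ.natDegree × expo s M,
      Polynomial.monomial (p.1 : ℕ) (monomial p.2.1 (e p)) := by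
    intro e
    simp [pol]
  have hcoeff : ∀ e i, (pol e).coeff i = ∑ p : Fin μ.natDegree × expo s M,
      if (p.1 : ℕ) = i then monomial p.2.1 (e p) else 0 := by
    intro e i
    rw [hpol, Polynomial.finset_sum_coeff]
    simp [Polynomial.coeff_monomial]
  have hpinj : ∀ e, pol e = 0 → e = 0 := by
    intro e he
    funext p
    have h1 := congrArg (coeff p.2.1) (hcoeff e p.1)
    rw [he, Polynomial.coeff_zero, coeff_zero, coeff_sum, Finset.sum_eq_single p] at h1
    · simpa using h1.symm
    · rintro ⟨a, b⟩ - hne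
      split_ifs with hi
      · rw [coeff_monomial, if_neg]
        intro h
        apply hne
        exact Prod.ext (Fin.ext hi) (Subtype.ext h)
      · simp
    · simp
  have hpdeg : ∀ e, (pol e).degree < μ.natDegree := by
    intro e
    rw [hpol]
    refine (Polynomial.degree_sum_le _ _).trans_lt ?_
    rw [Finset.sup_lt_iff (by exact WithBot.bot_lt_coe _)]
    intro p _
    refine (Polynomial.degree_monomial_le _ _).trans_lt ?_
    exact_mod_cast p.1.2
  let sb : Polynomial (MvPolynomial (Fin s) K) →ₗ[K] MvPolynomial (Fin n) K :=
    { toFun := fun P => subst l P (lin c)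
      map_add' := fun P Q => by simp [RSV.subst, Polynomial.eval₂_add]
      map_smul' := fun a P => by
        have : a • P = Polynomial.C (C a) * P := by
          rw [← Polynomial.smul_eq_C_mul, ← algebraMap_eq, algebraMap_smul]
        rw [this]
        simp [RSV.subst, Polynomial.eval₂_mul, smul_eq_C_mul] }
  have hinj2 : Function.Injective (Λ ∘ₗ sb ∘ₗ pol) := by
    rw [injective_iff_map_eq_zero]
    intro e he
    have h1 := hΛ (RSV.subst l (pol e) (lin c)) (by
      refine sub_deg l q _ M hq _ _ (lin_deg c) ?_ ?_
      · exact Polynomial.natDegree_le_of_degree_le (hpdeg e).le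
      · intro i
        rw [hcoeff]
        refine totalDegree_finsetSum_le fun p _ => ?_
        split_ifs
        · refine (totalDegree_monomial_le _ _).trans ?_
          have := mem_expo.1 p.2.2
          rw [Finsupp.sum_fintype _ _ (fun _ => rfl)]
          exact this
        · simp) he
    rw [subst_aeval x l hl] at h1
    apply hpinj
    have h2 := minpoly.isIntegrallyClosed_dvd hz h1
    by_contra hne
    have h3 := Polynomial.degree_le_of_dvd h2 hne
    rw [Polynomial.degree_eq_natDegree (minpoly.ne_zero hz)] at h3
    exact absurd (hpdeg e) (not_lt.2 h3)
  have h1 := LinearMap.finrank_le_finrank_of_injective hinj2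
  rw [Module.finrank_fintype_fun_eq_card, Module.finrank_fintype_fun_eq_card, Fintype.card_prod,
    Fintype.card_fin, Fintype.card_fin, Fintype.card_coe, card_expo] at h1
  exact h1

end count
end RSV


namespace RSV
set_option linter.all false
set_option linter.unusedSectionVars false
set_option linter.unusedSimpArgs false
set_option linter.style.haveILetI false

theorem dim_of_integral (A B : Type*) [CommRing A] [CommRing B] [Algebra A B]
    [Algebra.IsIntegral A B] [FaithfulSMul A B] : ringKrullDim B = ringKrullDim A := by
  apply le_antisymm
  · refine Order.krullDim_le_of_strictMono (PrimeSpectrum.comap (algebraMap A B)) ?_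
    intro P Q h
    exact Ideal.IsIntegral.comap_lt_comap h
  · rw [ringKrullDim, Order.krullDim]
    refine iSup_le fun l => ?_
    obtain ⟨Q, hQ, hQ2⟩ := (Ideal.exists_ideal_over_prime_of_isIntegral
      (S := B) (RelSeries.head l).asIdeal ⊥ (by
        intro a ha
        have h1 : algebraMap A B a = 0 := ha
        rw [(FaithfulSMul.algebraMap_injective A B).eq_iff' (map_zero _)] at h1
        rw [h1]; exact Ideal.zero_mem _))
    haveI := hQ2.1
    haveI : Q.LiesOver (RelSeries.head l).asIdeal := ⟨hQ2.2.symm⟩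
    obtain ⟨L, hL, -⟩ := Ideal.exists_ltSeries_of_hasGoingUp (S := B) l Q
    rw [← hL]
    exact Order.LTSeries.length_le_krullDim L

section
variable {K L : Type*} [Field K] [IsAlgClosed K] [Field L] [Algebra K L] {n r : ℕ}

theorem dim_eq (P : Ideal (MvPolynomial (Fin n) K)) [P.IsPrime] (x : Fin n → L)
    (hP : ∀ h, aeval x h = 0 ↔ h ∈ P) [Algebra (MvPolynomial (Fin r) K) L]
    [IsScalarTower K (MvPolynomial (Fin r) K) L] [FaithfulSMul (MvPolynomial (Fin r) K) L]
    (l : Fin r → MvPolynomial (Fin n) K)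
    (hl : ∀ i, algebraMap (MvPolynomial (Fin r) K) L (X i) = aeval x (l i))
    (hx : ∀ j, IsIntegral (MvPolynomial (Fin r) K) (x j)) :
    ringKrullDim (MvPolynomial (Fin n) K ⧸ P) = r := by
  letI : Algebra (MvPolynomial (Fin r) K) (MvPolynomial (Fin n) K ⧸ P) :=
    ((Ideal.Quotient.mk P).comp (aeval l : _ →ₐ[K] MvPolynomial (Fin n) K).toRingHom).toAlgebra
  let ψ : (MvPolynomial (Fin n) K ⧸ P) →+* L := Ideal.Quotient.lift P (aeval x).toRingHom
    (fun a ha => (hP a).2 ha)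
  have hψ : Function.Injective ψ := by
    rw [injective_iff_map_eq_zero]
    intro a ha
    obtain ⟨a, rfl⟩ := Ideal.Quotient.mk_surjective a
    have : aeval x a = 0 := ha
    rw [Ideal.Quotient.eq_zero_iff_mem]
    exact (hP a).1 this
  let Ψ : (MvPolynomial (Fin n) K ⧸ P) →ₐ[MvPolynomial (Fin r) K] L := ⟨ψ, fun a => aeval_l x l hl a⟩
  haveI : Algebra.IsIntegral (MvPolynomial (Fin r) K) (MvPolynomial (Fin n) K ⧸ P) := by
    constructor
    intro b
    rw [← isIntegral_algHom_iff Ψ hψ]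
    obtain ⟨h, rfl⟩ := Ideal.Quotient.mk_surjective b
    have : Ψ (Ideal.Quotient.mk P h) = aeval x h := rfl
    rw [this]
    induction h using MvPolynomial.induction_on with
    | C a =>
      rw [aeval_C, IsScalarTower.algebraMap_apply K (MvPolynomial (Fin r) K) L]
      exact isIntegral_algebraMap
    | add p q hp hq => rw [map_add]; exact (hp rfl).add (hq rfl)
    | mul_X p i hp => rw [map_mul, aeval_X]; exact (hp rfl).mul (hx i)
  haveI : FaithfulSMul (MvPolynomial (Fin r) K) (MvPolynomial (Fin n) K ⧸ P) := by
    rw [faithfulSMul_iff_algebraMap_injective]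
    intro a b hab
    apply FaithfulSMul.algebraMap_injective (MvPolynomial (Fin r) K) L
    rw [← AlgHom.commutes Ψ, ← AlgHom.commutes Ψ, hab]
  rw [dim_of_integral (MvPolynomial (Fin r) K) (MvPolynomial (Fin n) K ⧸ P),
    MvPolynomial.ringKrullDim_of_isNoetherianRing]
  simp
end

/-- The conclusion of the structure theory of a prime ideal. -/
def Core {K : Type*} [Field K] {n : ℕ} (P : Ideal (MvPolynomial (Fin n) K)) (q r ρ : ℕ) : Prop :=
  1 ≤ ρ ∧ ringKrullDim (MvPolynomial (Fin n) K ⧸ P) = r ∧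
  (∃ (c : Fin r → Fin n → K) (y0 : Fin r → K), LinearIndependent K c ∧
    {w : Fin n → K | (∀ h ∈ P, eval w h = 0) ∧ ∀ i, ∑ j, c i j * w j = y0 i}.Finite ∧
    ρ ≤ {w : Fin n → K | (∀ h ∈ P, eval w h = 0) ∧ ∀ i, ∑ j, c i j * w j = y0 i}.ncard) ∧
  (∀ D : ℕ, ∃ Λ : MvPolynomial (Fin n) K →ₗ[K] (Fin (ρ * (D + r).choose r) → K),
      ∀ f, f.totalDegree ≤ D → Λ f = 0 → f ∈ P) ∧
  (∀ p : Fin n → K, ¬ (∀ h ∈ P, eval p h = 0) → ∃ G ∈ P, G.totalDegree ≤ ρ ∧ eval p G ≠ 0) ∧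
  (∀ Y : Finset (Fin n → K), (∀ w ∈ Y, (∀ h ∈ P, eval w h = 0) ∧ ∀ j, w j ^ q = w j) →
    Y.card ≤ ρ * q ^ r)

section core
variable {K L : Type*} [Field K] [IsAlgClosed K] [Field L] [Algebra K L] {n : ℕ}

theorem points_bound (p : ℕ) [Fact p.Prime] [CharP K p] (P : Ideal (MvPolynomial (Fin n) K)) [P.IsPrime]
    (x : Fin n → L) (hP : ∀ h, aeval x h = 0 ↔ h ∈ P) (q r ρ : ℕ) (hq : 2 ≤ q)
    (hdim : ringKrullDim (MvPolynomial (Fin n) K ⧸ P) = r)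
    (hΛ : ∀ D : ℕ, ∃ Λ : MvPolynomial (Fin n) K →ₗ[K] (Fin (ρ * (D + r).choose r) → K),
      ∀ f, f.totalDegree ≤ D → Λ f = 0 → aeval x f = 0)
    (Y : Finset (Fin n → K)) (hY : ∀ w ∈ Y, Pt x w ∧ ∀ j, w j ^ q = w j) :
    Y.card ≤ ρ * q ^ r := by
  obtain ⟨r', c, hind, hitg, -⟩ := noether (K := K) p n (fun j => x j ^ q - x j)
  let v : Fin r' → L := fun i => ∑ j, c i j • (x j ^ q - x j)
  letI : Algebra (MvPolynomial (Fin r') K) L := (aeval v : _ →ₐ[K] L).toRingHom.toAlgebra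
  have hmap : ∀ a, algebraMap (MvPolynomial (Fin r') K) L a = aeval v a := fun _ => rfl
  haveI : IsScalarTower K (MvPolynomial (Fin r') K) L := IsScalarTower.of_algebraMap_eq fun a => by
    rw [hmap, algebraMap_eq, aeval_C]
  haveI : FaithfulSMul (MvPolynomial (Fin r') K) L := by
    rw [faithfulSMul_iff_algebraMap_injective]
    exact hind
  let l : Fin r' → MvPolynomial (Fin n) K := fun i => ∑ j, C (c i j) * (X j ^ q - X j)
  have hl : ∀ i, algebraMap (MvPolynomial (Fin r') K) L (X i) = aeval x (l i) := by
    intro i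
    rw [hmap, aeval_X]
    simp [l, v, Algebra.smul_def]
  have hu : ∀ j, IsIntegral (MvPolynomial (Fin r') K) (x j ^ q - x j) := by
    intro j
    refine (wt_minpoly _ 1 ?_).1
    have e : (fun i : Fin r' => algebraMap (MvPolynomial (Fin r') K) L (X i)) = v := by
      funext i
      rw [hmap, aeval_X]
    rw [Wt, e, pow_one]
    exact hitg j
  have hx : ∀ j, IsIntegral (MvPolynomial (Fin r') K) (x j) := by
    intro j
    have h1 : IsIntegral (integralClosure (MvPolynomial (Fin r') K) L) (x j) := by
      refine ⟨Polynomial.X ^ q - Polynomial.X - Polynomial.C ⟨_, hu j⟩, ?_, ?_⟩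
      · have := Polynomial.monic_X_pow_sub (R := integralClosure (MvPolynomial (Fin r') K) L)
          (n := q) (p := Polynomial.X + Polynomial.C ⟨_, hu j⟩) (by
            rw [Polynomial.degree_X_add_C]
            exact_mod_cast (by omega : 1 < q))
        rw [sub_sub]
        exact this
      · simp
    exact isIntegral_trans (R := MvPolynomial (Fin r') K) (A := integralClosure (MvPolynomial (Fin r') K) L) _ h1
  have hr : r = r' := by
    have := dim_eq P x hP l hl hx
    rw [hdim] at this
    exact_mod_cast this
  subst hr
  refine count_ineq x l hl hx q ρ r ?_ hΛ Y ?_ rfl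
  · intro i
    refine totalDegree_finsetSum_le fun j _ => ?_
    refine (totalDegree_mul _ _).trans ?_
    rw [totalDegree_C, zero_add]
    refine (totalDegree_sub _ _).trans ?_
    rw [totalDegree_X_pow, totalDegree_X]
    exact max_le le_rfl (by omega)
  · intro w hw
    refine ⟨(hY w hw).1, fun i => ?_⟩
    simp [l, (hY w hw).2]

theorem core_aux (p : ℕ) [Fact p.Prime] [CharP K p] (P : Ideal (MvPolynomial (Fin n) K)) [P.IsPrime]
    (q : ℕ) (hq : 2 ≤ q) (x : Fin n → L) (hP : ∀ h, aeval x h = 0 ↔ h ∈ P)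
    (hfrac : ∀ α : L, ∃ a b : MvPolynomial (Fin n) K, aeval x b ≠ 0 ∧ α = aeval x a / aeval x b) :
    ∃ r ρ, Core P q r ρ := by
  have hPt : ∀ w, Pt x w ↔ ∀ h ∈ P, eval w h = 0 := by
    intro w
    simp only [Pt, hP]
  obtain ⟨r, c, hind, hitg, hsep⟩ := noether (K := K) p n x
  let y : Fin r → L := fun i => ∑ j, c i j • x j
  letI : Algebra (MvPolynomial (Fin r) K) L := (aeval y : _ →ₐ[K] L).toRingHom.toAlgebra
  have hmap : ∀ a, algebraMap (MvPolynomial (Fin r) K) L a = aeval y a := fun _ => rfl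
  haveI : IsScalarTower K (MvPolynomial (Fin r) K) L := IsScalarTower.of_algebraMap_eq fun a => by
    rw [hmap, algebraMap_eq, aeval_C]
  haveI : FaithfulSMul (MvPolynomial (Fin r) K) L := by
    rw [faithfulSMul_iff_algebraMap_injective]
    exact hind
  let l : Fin r → MvPolynomial (Fin n) K := fun i => lin (c i)
  have hl : ∀ i, algebraMap (MvPolynomial (Fin r) K) L (X i) = aeval x (l i) := by
    intro i
    rw [hmap, aeval_X, lin_aeval]
  have hl1 : ∀ i, (l i).totalDegree ≤ 1 := fun i => lin_deg _
  have hx : ∀ j, Wt K (fun i : Fin r => algebraMap (MvPolynomial (Fin r) K) L (X i)) 1 (x j) := by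
    intro j
    have e : (fun i : Fin r => algebraMap (MvPolynomial (Fin r) K) L (X i)) = y := by
      funext i
      rw [hmap, aeval_X]
    rw [Wt, e, pow_one]
    exact hitg j
  let k := IntermediateField.adjoin K (Set.range y)
  letI : Algebra (MvPolynomial (Fin r) K) k := ((hind.aevalEquivField : FractionRing (MvPolynomial (Fin r) K) →+* k).comp
    (algebraMap _ (FractionRing (MvPolynomial (Fin r) K)))).toAlgebra
  haveI : IsScalarTower (MvPolynomial (Fin r) K) k L := IsScalarTower.of_algebraMap_eq fun a =>
    (hind.aevalEquivField_algebraMap_apply_coe a).symm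
  haveI : IsFractionRing (MvPolynomial (Fin r) K) k := by
    let e : FractionRing (MvPolynomial (Fin r) K) ≃ₐ[MvPolynomial (Fin r) K] k :=
      { (hind.aevalEquivField : FractionRing (MvPolynomial (Fin r) K) ≃+* k) with
        commutes' := fun a => rfl }
    exact IsFractionRing.of_algEquiv e
  have htop : IntermediateField.adjoin k (Set.range x) = ⊤ := by
    rw [eq_top_iff]
    rintro α -
    obtain ⟨a, b, hb, rfl⟩ := hfrac α
    have hmem : ∀ h : MvPolynomial (Fin n) K, aeval x h ∈ IntermediateField.adjoin k (Set.range x) := by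
      intro h
      induction h using MvPolynomial.induction_on with
      | C a =>
        rw [aeval_C, IsScalarTower.algebraMap_apply K k L]
        exact IntermediateField.algebraMap_mem _ _
      | add p q hp hq => rw [map_add]; exact add_mem hp hq
      | mul_X p i hp =>
        rw [map_mul, aeval_X]
        exact mul_mem hp (IntermediateField.subset_adjoin _ _ ⟨i, rfl⟩)
    exact div_mem (hmem a) (hmem b)
  haveI hfd : FiniteDimensional k L := by
    haveI := IntermediateField.finiteDimensional_adjoin (K := k) (S := Set.range x) (by
      rintro _ ⟨j, rfl⟩
      exact (hsep j).isIntegral)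
    rw [htop] at this
    exact LinearEquiv.finiteDimensional (IntermediateField.topEquiv (F := k) (E := L)).toLinearEquiv
  haveI hsepL : Algebra.IsSeparable k L := by
    have h1 := (IntermediateField.isSeparable_adjoin_iff_isSeparable k L (S := Set.range x)).2 (by
      rintro _ ⟨j, rfl⟩
      exact hsep j)
    rw [htop] at h1
    exact (AlgEquiv.Algebra.isSeparable_iff (IntermediateField.topEquiv (F := k) (E := L))).1 h1
  obtain ⟨α, hα⟩ := Field.exists_primitive_element k L
  -- integral primitive element in `K[x]`
  obtain ⟨g, hg⟩ : ∃ g : MvPolynomial (Fin n) K, IntermediateField.adjoin k {aeval x g} = ⊤ := by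
    obtain ⟨a, b, hb0, rfl⟩ := hfrac α
    have hbi := int_aeval x hx b
    let μ := minpoly (MvPolynomial (Fin r) K) (aeval x b)
    have hμ : Polynomial.aeval (aeval x b) μ.divX * aeval x b + algebraMap _ L (μ.coeff 0) = 0 := by
      have := minpoly.aeval (MvPolynomial (Fin r) K) (aeval x b)
      rw [← Polynomial.divX_mul_X_add (minpoly (MvPolynomial (Fin r) K) (aeval x b))] at this
      simpa using this
    have hc0 : μ.coeff 0 ≠ 0 := by
      intro h0
      have h1 := minpoly.coeff_zero_ne_zero (A := k) hbi.tower_top hb0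
      rw [minpoly.isIntegrallyClosed_eq_field_fractions' k hbi, Polynomial.coeff_map] at h1
      exact h1 (by rw [show (minpoly (MvPolynomial (Fin r) K) (aeval x b)).coeff 0 = 0 from h0, map_zero])
    have hc1 : algebraMap _ L (μ.coeff 0) ≠ 0 := by
      rw [Ne, (FaithfulSMul.algebraMap_injective _ L).eq_iff' (map_zero _)]
      exact hc0
    refine ⟨- (a * subst l μ.divX b), ?_⟩
    rw [map_neg, map_mul, subst_aeval x l hl, eq_top_iff, ← hα, IntermediateField.adjoin_le_iff,
      Set.singleton_subset_iff]
    have e : aeval x a / aeval x b = -(aeval x a * Polynomial.aeval (aeval x b) μ.divX) /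
        algebraMap k L (algebraMap _ k (μ.coeff 0)) := by
      rw [← IsScalarTower.algebraMap_apply, div_eq_div_iff hb0 hc1]
      linear_combination (aeval x a) * hμ
    rw [e]
    exact div_mem (IntermediateField.mem_adjoin_simple_self _ _) (IntermediateField.algebraMap_mem _ _)
  have hzk : IsIntegral k (aeval x g) := (int_aeval x hx g).tower_top
  obtain ⟨pb, hpb⟩ : ∃ pb : PowerBasis k L, pb.gen = aeval x g :=
    ⟨((IntermediateField.adjoin.powerBasis hzk).map
      ((IntermediateField.equivOfEq hg).trans IntermediateField.topEquiv)), by simp⟩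
  have hzi : IsIntegral (MvPolynomial (Fin r) K) pb.gen := hpb ▸ int_aeval x hx g
  have hdim := dim_eq P x hP l hl (int_of_wt x hx)
  obtain ⟨y0, hy0⟩ := many_points x l hl hx pb g hpb
  refine ⟨r, Module.finrank k L, Module.finrank_pos, hdim, ⟨c, y0, ?_, ?_, ?_⟩, ?_, ?_, ?_⟩
  · have h1 : LinearIndependent K y := hind.linearIndependent
    exact LinearIndependent.of_comp (∑ j, (LinearMap.proj j : (Fin n → K) →ₗ[K] K).smulRight (x j)) (by
      convert h1 using 1
      funext i
      simp [y])
  · have := fib_finite x l hl (int_of_wt x hx) y0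
    simpa only [hPt, l, lin_eval] using this
  · simpa only [hPt, l, lin_eval] using hy0
  · intro D
    simpa only [hP] using hilbert_poly x hx pb hzi D
  · intro p hp
    rw [← hPt] at hp
    obtain ⟨G, h1, h2, h3⟩ := separation (k := k) x l hl hl1 hx p hp
    exact ⟨G, (hP G).1 h1, h2, h3⟩
  · intro Y hY
    refine points_bound p P x hP q r _ hq hdim (fun D => hilbert_poly x hx pb hzi D) Y ?_
    intro w hw
    rw [hPt]
    exact hY w hw

theorem core (p : ℕ) [Fact p.Prime] [CharP K p] (P : Ideal (MvPolynomial (Fin n) K)) [P.IsPrime]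
    (q : ℕ) (hq : 2 ≤ q) : ∃ r ρ, Core P q r ρ := by
  let L := FractionRing (MvPolynomial (Fin n) K ⧸ P)
  let x : Fin n → L := fun j => algebraMap _ L (Ideal.Quotient.mk P (X j))
  have hxa : ∀ h, aeval x h = algebraMap _ L (Ideal.Quotient.mk P h) := by
    intro h
    have : (aeval x : _ →ₐ[K] L) = (IsScalarTower.toAlgHom K (MvPolynomial (Fin n) K ⧸ P) L).comp
        (Ideal.Quotient.mkₐ K P) := by
      apply MvPolynomial.algHom_ext
      intro i
      simp [x]
    rw [this]
    rfl
  have hP : ∀ h, aeval x h = 0 ↔ h ∈ P := by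
    intro h
    rw [hxa, (IsFractionRing.injective _ L).eq_iff' (map_zero _), Ideal.Quotient.eq_zero_iff_mem]
  refine core_aux (L := L) p P q hq x hP ?_
  intro α
  obtain ⟨a, b, hb, rfl⟩ := IsFractionRing.div_surjective (MvPolynomial (Fin n) K ⧸ P) α
  obtain ⟨a, rfl⟩ := Ideal.Quotient.mk_surjective a
  obtain ⟨b, rfl⟩ := Ideal.Quotient.mk_surjective b
  refine ⟨a, b, ?_, ?_⟩
  · rw [hxa]
    exact IsFractionRing.to_map_ne_zero_of_mem_nonZeroDivisors hb
  · rw [hxa, hxa]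

end core
end RSV

namespace RSV
set_option linter.all false
set_option linter.unusedSectionVars false
set_option linter.unusedSimpArgs false
set_option linter.style.haveILetI false

section top
variable {K : Type*} [Field K] {n : ℕ}

theorem isClosed_zl (S : Set (MvPolynomial (Fin n) K)) : IsClosed (_root_.zeroLocus K n S) := by
  rw [← isOpen_compl_iff]
  exact TopologicalSpace.isOpen_generateFrom_of_mem ⟨S, rfl⟩

theorem isOpen_zl (U : Set (Fin n → K)) (hU : IsOpen U) :
    ∃ S : Set (MvPolynomial (Fin n) K), U = (_root_.zeroLocus K n S)ᶜ := by
  have hU : TopologicalSpace.GenerateOpen _ U := hU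
  induction hU with
  | basic s hs => exact hs
  | univ => exact ⟨{1}, by ext x; simp [_root_.zeroLocus]⟩
  | inter s t hs ht ih1 ih2 =>
    obtain ⟨S, rfl⟩ := ih1 hs
    obtain ⟨T, rfl⟩ := ih2 ht
    refine ⟨{h | ∃ f ∈ S, ∃ g ∈ T, h = f * g}, ?_⟩
    ext x
    constructor
    · rintro ⟨h1, h2⟩ h3
      simp only [_root_.zeroLocus, Set.mem_compl_iff, Set.mem_setOf_eq, not_forall] at h1 h2
      obtain ⟨f, hf, hf0⟩ := h1
      obtain ⟨g, hg, hg0⟩ := h2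
      have := h3 (f * g) ⟨f, hf, g, hg, rfl⟩
      rw [map_mul] at this
      exact (mul_ne_zero hf0 hg0) this
    · intro h
      constructor
      · intro h1
        apply h
        rintro _ ⟨f, hf, g, hg, rfl⟩
        rw [map_mul, h1 f hf, zero_mul]
      · intro h1
        apply h
        rintro _ ⟨f, hf, g, hg, rfl⟩
        rw [map_mul, h1 g hg, mul_zero]
  | sUnion A hA ih =>
    choose! T hT using ih
    refine ⟨⋃ s ∈ A, T s, ?_⟩
    ext x
    simp only [Set.mem_sUnion, Set.mem_compl_iff]
    constructor
    · rintro ⟨s, hs, hx⟩ h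
      rw [hT s hs (hA s hs)] at hx
      apply hx
      intro f hf
      exact h f (Set.mem_biUnion hs hf)
    · intro h
      by_contra! h1
      apply h
      intro f hf
      simp only [Set.mem_iUnion] at hf
      obtain ⟨s, hs, hf⟩ := hf
      have := h1 s hs
      rw [hT s hs (hA s hs), Set.notMem_compl_iff] at this
      exact this f hf

theorem closed_zl (W : Set (Fin n → K)) (hW : IsClosed W) :
    ∃ S : Set (MvPolynomial (Fin n) K), W = _root_.zeroLocus K n S := by
  obtain ⟨S, hS⟩ := isOpen_zl Wᶜ hW.isOpen_compl
  exact ⟨S, by rw [← compl_compl W, hS, compl_compl]⟩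

theorem zl_vi (W : Set (Fin n → K)) (hW : IsClosed W) :
    _root_.zeroLocus K n (_root_.vanishingIdeal K n W : Set (MvPolynomial (Fin n) K)) = W := by
  obtain ⟨S, rfl⟩ := closed_zl W hW
  ext x
  constructor
  · intro h f hf
    exact h f (fun y hy => hy f hf)
  · intro h f hf
    exact hf x h

theorem vi_prime (W : Set (Fin n → K)) (hW : IsIrreducible W) :
    (_root_.vanishingIdeal K n W).IsPrime := by
  constructor
  · intro h
    obtain ⟨x, hx⟩ := hW.1
    have : (1 : MvPolynomial (Fin n) K) ∈ _root_.vanishingIdeal K n W := h ▸ Submodule.mem_top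
    have := this x hx
    simp at this
  · intro f g hfg
    have := isPreirreducible_iff_isClosed_union_isClosed.1 hW.2 _ _ (isClosed_zl {f}) (isClosed_zl {g}) (by
      intro x hx
      have := hfg x hx
      rw [map_mul, mul_eq_zero] at this
      simpa [_root_.zeroLocus] using this)
    rcases this with h | h
    · exact Or.inl fun x hx => by simpa [_root_.zeroLocus] using h hx
    · exact Or.inr fun x hx => by simpa [_root_.zeroLocus] using h hx

variable [IsAlgClosed K]

theorem vi_zl (P : Ideal (MvPolynomial (Fin n) K)) [P.IsPrime] :
    _root_.vanishingIdeal K n (_root_.zeroLocus K n (P : Set (MvPolynomial (Fin n) K))) = P := by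
  have h := MvPolynomial.IsPrime.vanishingIdeal_zeroLocus (K := K) P
  ext f
  conv_rhs => rw [← h]
  rw [MvPolynomial.mem_vanishingIdeal_iff]
  simp only [MvPolynomial.mem_zeroLocus_iff, MvPolynomial.coe_aeval_eq_eval]
  rfl

theorem zl_irr (P : Ideal (MvPolynomial (Fin n) K)) [hP : P.IsPrime] :
    IsIrreducible (_root_.zeroLocus K n (P : Set (MvPolynomial (Fin n) K))) := by
  constructor
  · by_contra h
    rw [Set.not_nonempty_iff_eq_empty] at h
    have h1 := vi_zl P
    rw [h] at h1
    apply hP.ne_top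
    rw [← h1, Ideal.eq_top_iff_one]
    intro x hx
    exact hx.elim
  · rw [isPreirreducible_iff_isClosed_union_isClosed]
    intro A B hA hB hAB
    by_contra! h
    obtain ⟨S, rfl⟩ := closed_zl A hA
    obtain ⟨T, rfl⟩ := closed_zl B hB
    obtain ⟨h1, h2⟩ := h
    rw [Set.not_subset] at h1 h2
    obtain ⟨a, ha, ha'⟩ := h1
    obtain ⟨b, hb, hb'⟩ := h2
    simp only [_root_.zeroLocus, Set.mem_setOf_eq, not_forall] at ha' hb'
    obtain ⟨f, hf, hf0⟩ := ha'
    obtain ⟨g, hg, hg0⟩ := hb'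
    have : f * g ∈ P := by
      rw [← vi_zl P]
      intro x hx
      rw [map_mul]
      rcases hAB hx with h | h
      · rw [h f hf, zero_mul]
      · rw [h g hg, mul_zero]
    rcases hP.mem_or_mem this with h | h
    · exact hf0 (ha f h)
    · exact hg0 (hb g h)

theorem vdim_zl (P : Ideal (MvPolynomial (Fin n) K)) [hP : P.IsPrime] :
    vdim K n (_root_.zeroLocus K n (P : Set (MvPolynomial (Fin n) K))) =
      ringKrullDim (MvPolynomial (Fin n) K ⧸ P) := by
  rw [ringKrullDim_quotient, vdim, topologicalKrullDim]
  have hcl := isClosed_zl (P : Set (MvPolynomial (Fin n) K))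
  set W := _root_.zeroLocus K n (P : Set (MvPolynomial (Fin n) K)) with hWdef
  apply le_antisymm
  · rw [← Order.krullDim_orderDual (α := PrimeSpectrum.zeroLocus (P : Set (MvPolynomial (Fin n) K)))]
    refine Order.krullDim_le_of_strictMono (fun C : TopologicalSpace.IrreducibleCloseds W =>
      OrderDual.toDual (⟨⟨_root_.vanishingIdeal K n (Subtype.val '' C.carrier),
        vi_prime _ (C.isIrreducible'.image _ continuous_subtype_val.continuousOn)⟩, ?_⟩ :
          PrimeSpectrum.zeroLocus (P : Set (MvPolynomial (Fin n) K)))) ?_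
    · rintro f hf _ ⟨x, hx, rfl⟩
      exact x.2 f hf
    · intro C D hCD
      have hle : C.carrier ⊆ D.carrier := hCD.le
      have hne : ¬ D.carrier ⊆ C.carrier := fun h => hCD.not_ge h
      have hC : IsClosed (Subtype.val '' C.carrier) := hcl.isClosedEmbedding_subtypeVal.isClosedMap _ C.isClosed'
      have hD : IsClosed (Subtype.val '' D.carrier) := hcl.isClosedEmbedding_subtypeVal.isClosedMap _ D.isClosed'
      refine OrderDual.toDual_lt_toDual.2 (lt_of_le_not_ge ?_ ?_)
      · intro f hf x hx
        exact hf x (Set.image_mono hle hx)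
      · intro h
        apply hne
        rw [← Set.image_subset_image_iff Subtype.val_injective, ← zl_vi _ hC, ← zl_vi _ hD]
        intro x hx f hf
        exact hx f (h hf)
  · rw [← Order.krullDim_orderDual (α := TopologicalSpace.IrreducibleCloseds W)]
    have hsub : ∀ Q : PrimeSpectrum.zeroLocus (P : Set (MvPolynomial (Fin n) K)),
        Subtype.val '' (Subtype.val ⁻¹' (_root_.zeroLocus K n (Q.1.asIdeal : Set (MvPolynomial (Fin n) K))) : Set W)
          = _root_.zeroLocus K n (Q.1.asIdeal : Set (MvPolynomial (Fin n) K)) := by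
      intro Q
      rw [Subtype.image_preimage_coe, Set.inter_eq_right]
      intro x hx f hf
      exact hx f (Q.2 hf)
    refine Order.krullDim_le_of_strictMono (fun Q => OrderDual.toDual
      (⟨Subtype.val ⁻¹' (_root_.zeroLocus K n (Q.1.asIdeal : Set (MvPolynomial (Fin n) K))), ?_, ?_⟩ :
        TopologicalSpace.IrreducibleCloseds W)) ?_
    · have := zl_irr Q.1.asIdeal
      rw [← hsub Q] at this
      refine ⟨Set.image_nonempty.1 this.1, ?_⟩
      rw [isPreirreducible_iff_isClosed_union_isClosed]
      intro A B hA hB hAB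
      rcases isPreirreducible_iff_isClosed_union_isClosed.1 this.2 _ _
        (hcl.isClosedEmbedding_subtypeVal.isClosedMap _ hA)
        (hcl.isClosedEmbedding_subtypeVal.isClosedMap _ hB)
        (by rw [← Set.image_union]; exact Set.image_mono hAB) with h | h
      · exact Or.inl ((Set.image_subset_image_iff Subtype.val_injective).1 h)
      · exact Or.inr ((Set.image_subset_image_iff Subtype.val_injective).1 h)
    · exact (isClosed_zl _).preimage continuous_subtype_val
    · intro Q Q' h
      refine OrderDual.toDual_lt_toDual.2 (lt_of_le_not_ge ?_ ?_)
      · intro x hx f hf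
        exact hx f (h.le hf)
      · intro h1
        apply h.not_ge
        have h2 : _root_.zeroLocus K n (Q.1.asIdeal : Set (MvPolynomial (Fin n) K)) ⊆
          _root_.zeroLocus K n (Q'.1.asIdeal : Set (MvPolynomial (Fin n) K)) := by
          rw [← hsub Q, ← hsub Q']
          exact Set.image_mono h1
        intro f hf
        change f ∈ Q.1.asIdeal
        rw [← vi_zl Q.1.asIdeal]
        intro x hx
        exact h2 hx f hf

theorem topdim_aff (m : ℕ) : topologicalKrullDim (Fin m → K) = m := by
  have h := vdim_zl (⊥ : Ideal (MvPolynomial (Fin m) K))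
  have e : _root_.zeroLocus K m ((⊥ : Ideal (MvPolynomial (Fin m) K)) : Set (MvPolynomial (Fin m) K)) = Set.univ := by
    ext x
    simp [_root_.zeroLocus]
  rw [e, vdim, (Homeomorph.Set.univ (Fin m → K)).isHomeomorph.topologicalKrullDim_eq,
    ringKrullDim_eq_of_ringEquiv (RingEquiv.quotientBot _),
    MvPolynomial.ringKrullDim_of_isNoetherianRing] at h
  rw [h]
  simp

theorem cont_poly {m : ℕ} (g : Fin m → MvPolynomial (Fin n) K) :
    Continuous (fun w : Fin n → K => (fun i => eval w (g i) : Fin m → K)) := by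
  rw [continuous_iff_isClosed]
  intro s hs
  obtain ⟨S, rfl⟩ := closed_zl s hs
  convert isClosed_zl ((fun f => aeval g f) '' S) using 1
  ext w
  simp only [_root_.zeroLocus, Set.mem_preimage, Set.mem_setOf_eq, Set.forall_mem_image]
  have : ∀ f, eval w (aeval g f) = eval (fun i => eval w (g i)) f := by
    intro f
    rw [aeval_def, eval₂_eq_eval_map]
    induction f using MvPolynomial.induction_on with
    | C a => simp
    | add p q hp hq => simp [hp, hq] at *; rw [hp, hq]
    | mul_X p i hp => simp at *; rw [hp]; exact Or.inl rfl
  simp only [this]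

theorem cont_affine {m : ℕ} (T : (Fin n → K) →ₗ[K] (Fin m → K)) (b : Fin m → K) :
    Continuous (fun w : Fin n → K => T w + b) := by
  have := cont_poly (K := K) (fun i : Fin m => ∑ j : Fin n, C (T (Pi.single j 1) i) * X j + C (b i))
  convert this using 1
  funext w i
  conv_lhs => rw [show w = ∑ j, w j • Pi.single (M := fun _ => K) j 1 by
    funext i; simp [Finset.sum_apply, Pi.single_apply]]
  simp only [map_sum, map_smul, Pi.add_apply, Finset.sum_apply, Pi.smul_apply, smul_eq_mul, map_add,
    map_mul, eval_C, eval_X]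
  congr 1
  exact Finset.sum_congr rfl fun j _ => mul_comm _ _

theorem vdim_linear (r : ℕ) (c : Fin r → Fin n → K) (hc : LinearIndependent K c) (y0 : Fin r → K) :
    vdim K n {w : Fin n → K | ∀ i, ∑ j, c i j * w j = y0 i} = ((n - r : ℕ) : WithBot ℕ∞) ∧ r ≤ n := by
  let T : (Fin n → K) →ₗ[K] (Fin r → K) := (Matrix.of c).mulVecLin
  have hT : ∀ w i, T w i = ∑ j, c i j * w j := fun w i => rfl
  have hrank : Module.finrank K (LinearMap.range T) = r := by
    have := LinearIndependent.rank_matrix (M := Matrix.of c) hc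
    rw [Matrix.rank, Fintype.card_fin] at this
    exact this
  have hsurj : Function.Surjective T := by
    rw [← LinearMap.range_eq_top]
    apply Submodule.eq_top_of_finrank_eq
    rw [hrank, Module.finrank_fin_fun]
  have hrn := LinearMap.finrank_range_add_finrank_ker T
  rw [hrank, Module.finrank_fin_fun] at hrn
  refine ⟨?_, by omega⟩
  obtain ⟨w0, hw0⟩ := hsurj y0
  let e : (Fin (n - r) → K) ≃ₗ[K] LinearMap.ker T := LinearEquiv.ofFinrankEq _ _ (by
    rw [Module.finrank_fin_fun]; omega)
  let f : (Fin (n - r) → K) →ₗ[K] (Fin n → K) := (LinearMap.ker T).subtype.comp e.toLinearMap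
  have hf : LinearMap.ker f = ⊥ := by
    rw [LinearMap.ker_eq_bot]
    exact Subtype.val_injective.comp e.injective
  obtain ⟨g, hg⟩ := LinearMap.exists_leftInverse_of_injective f hf
  have hgf : ∀ u, g (f u) = u := fun u => by
    rw [← LinearMap.comp_apply, hg]; rfl
  have hTf : ∀ u, T (f u) = 0 := fun u => (e u).2
  let H : {w : Fin n → K | ∀ i, ∑ j, c i j * w j = y0 i} ≃ₜ (Fin (n - r) → K) :=
    { toFun := fun w => g w.1 + (- g w0)
      invFun := fun u => ⟨f u + w0, fun i => by
        rw [← hT, map_add, hTf, zero_add, hw0]⟩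
      left_inv := by
        rintro ⟨w, hw⟩
        apply Subtype.ext
        have h1 : w - w0 ∈ LinearMap.ker T := by
          rw [LinearMap.mem_ker, map_sub, hw0, sub_eq_zero]
          funext i
          rw [hT]
          exact hw i
        have h2 : f (e.symm ⟨w - w0, h1⟩) = w - w0 := by simp [f]
        change f (g w + - g w0) + w0 = w
        rw [← sub_eq_add_neg, ← map_sub, ← h2, hgf, h2, sub_add_cancel]
      right_inv := by
        intro u
        change g (f u + w0) + - g w0 = u
        rw [map_add, hgf, add_neg_cancel_right]
      continuous_toFun := (cont_affine g _).comp continuous_subtype_val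
      continuous_invFun := (cont_affine f w0).subtype_mk _ }
  rw [vdim, H.isHomeomorph.topologicalKrullDim_eq, topdim_aff]

theorem irrDegree_ge (P : Ideal (MvPolynomial (Fin n) K)) [P.IsPrime] (q r ρ : ℕ) (h : Core P q r ρ) :
    (ρ : ℕ∞) ≤ irrDegree K n (_root_.zeroLocus K n (P : Set (MvPolynomial (Fin n) K))) := by
  obtain ⟨-, hdim, ⟨c, y0, hc, hfin, hρ⟩, -⟩ := h
  obtain ⟨h1, h2⟩ := vdim_linear r c hc y0
  set L := {w : Fin n → K | ∀ i, ∑ j, c i j * w j = y0 i} with hL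
  have e : _root_.zeroLocus K n (P : Set (MvPolynomial (Fin n) K)) ∩ L =
    {w : Fin n → K | (∀ h ∈ P, eval w h = 0) ∧ ∀ i, ∑ j, c i j * w j = y0 i} := rfl
  rw [← e] at hfin hρ
  rw [irrDegree]
  refine le_iSup_of_le L (le_iSup_of_le ?_ (le_iSup_of_le ?_ (le_iSup_of_le hfin (by exact_mod_cast hρ))))
  · refine ⟨Set.range fun i => lin (c i) - C (y0 i), ?_, ?_⟩
    · rintro _ ⟨i, rfl⟩
      refine (totalDegree_sub _ _).trans ?_
      rw [totalDegree_C]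
      exact max_le (lin_deg _) (by omega)
    · ext w
      simp only [hL, _root_.zeroLocus, Set.mem_setOf_eq, Set.forall_mem_range, map_sub, eval_C, lin_eval,
        sub_eq_zero]
  · rw [h1, vdim_zl, hdim]
    norm_cast
    omega

end top

theorem components {K : Type} [Field K] [IsAlgClosed K] {n : ℕ} (p : ℕ) [Fact p.Prime] [CharP K p] (q : ℕ) (hq : 2 ≤ q) (V : Set (Fin n → K))
    (hV : IsAffineVariety K n V) (d k : ℕ) (hd : 1 ≤ d) (hdeg : vdeg K n V = (d : ℕ∞))
    (hdim : vdim K n V = (k : WithBot ℕ∞)) :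
    ∃ (ι : Type) (_ : Fintype ι) (P : ι → Ideal (MvPolynomial (Fin n) K)) (r ρ : ι → ℕ),
      (∀ i, Core (P i) q (r i) (ρ i)) ∧ (∀ i, r i ≤ k) ∧ ∑ i, ρ i ≤ d ∧
      ∀ w, w ∈ V ↔ ∃ i, ∀ h ∈ P i, eval w h = 0 := by
  obtain ⟨s, rfl⟩ := hV
  have hcl := isClosed_zl (s : Set (MvPolynomial (Fin n) K))
  set V := _root_.zeroLocus K n (s : Set (MvPolynomial (Fin n) K))
  have hWcl : ∀ W : irreducibleComponents V, IsClosed (Subtype.val '' W.1) := fun W =>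
    hcl.isClosedEmbedding_subtypeVal.isClosedMap _ (isClosed_of_mem_irreducibleComponents _ W.2)
  have hWirr : ∀ W : irreducibleComponents V, IsIrreducible (Subtype.val '' W.1) := fun W =>
    W.2.1.image _ continuous_subtype_val.continuousOn
  let P : irreducibleComponents V → Ideal (MvPolynomial (Fin n) K) :=
    fun W => _root_.vanishingIdeal K n (Subtype.val '' W.1)
  haveI hP : ∀ W, (P W).IsPrime := fun W => vi_prime _ (hWirr W)
  have hzl : ∀ W, _root_.zeroLocus K n (P W : Set (MvPolynomial (Fin n) K)) = Subtype.val '' W.1 :=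
    fun W => zl_vi _ (hWcl W)
  choose r ρ hcore using fun W => core p (P W) q hq
  have hge : ∀ W : irreducibleComponents V, (ρ W : ℕ∞) ≤ irrDegree K n (Subtype.val '' W.1) := by
    intro W
    rw [← hzl W]
    exact irrDegree_ge (P W) q (r W) (ρ W) (hcore W)
  have hsum : Summable fun W : irreducibleComponents V => irrDegree K n (Subtype.val '' W.1) := by
    by_contra h
    rw [vdeg, tsum_eq_zero_of_not_summable h] at hdeg
    have : (0 : ℕ) = d := by exact_mod_cast hdeg
    omega
  have hfs : ∀ T : Finset (irreducibleComponents V), ∑ W ∈ T, ρ W ≤ d := by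
    intro T
    have h1 := Summable.sum_le_tsum T (fun _ _ => zero_le) hsum
    have h2 : ((∑ W ∈ T, ρ W : ℕ) : ℕ∞) ≤ d := by
      rw [← hdeg, vdeg]
      refine le_trans ?_ h1
      push_cast
      exact Finset.sum_le_sum fun W _ => hge W
    exact_mod_cast h2
  haveI : Finite (irreducibleComponents V) := by
    by_contra h
    rw [not_finite_iff_infinite] at h
    obtain ⟨T, hT⟩ := Infinite.exists_subset_card_eq (irreducibleComponents V) (d + 1)
    have h1 := hfs T
    have h2 : T.card ≤ ∑ W ∈ T, ρ W := by
      rw [Finset.card_eq_sum_ones]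
      exact Finset.sum_le_sum fun W _ => (hcore W).1
    omega
  refine ⟨irreducibleComponents V, Fintype.ofFinite _, P, r, ρ, hcore, ?_, hfs _, ?_⟩
  · intro W
    have h1 : vdim K n (Subtype.val '' W.1) ≤ vdim K n V := by
      refine Topology.IsInducing.topologicalKrullDim_le (f := Set.inclusion ?_) (Topology.IsEmbedding.inclusion _).isInducing
      rintro _ ⟨x, -, rfl⟩
      exact x.2
    rw [hdim, ← hzl W, vdim_zl, (hcore W).2.1] at h1
    exact_mod_cast h1
  · intro w
    constructor
    · intro hw
      refine ⟨⟨irreducibleComponent ⟨w, hw⟩, irreducibleComponent_mem_irreducibleComponents _⟩, ?_⟩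
      intro h hh
      exact hh w ⟨⟨w, hw⟩, mem_irreducibleComponent, rfl⟩
    · rintro ⟨W, hW⟩
      have : w ∈ _root_.zeroLocus K n (P W : Set (MvPolynomial (Fin n) K)) := hW
      rw [hzl W] at this
      obtain ⟨x, -, rfl⟩ := this
      exact x.2
end RSV


namespace RSV
set_option linter.all false
set_option linter.unusedSectionVars false
set_option linter.unusedSimpArgs false
set_option linter.style.haveILetI false

section comb

theorem choose_pow (s N t : ℕ) (h : s ≤ N) : s.choose t * N ^ t ≤ N.choose t * s ^ t := by
  have h1 : s.descFactorial t * N ^ t ≤ N.descFactorial t * s ^ t := by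
    induction t with
    | zero => simp
    | succ t ih =>
      rw [Nat.descFactorial_succ, Nat.descFactorial_succ, pow_succ, pow_succ]
      have h2 : (s - t) * N ≤ (N - t) * s := by
        rw [Nat.sub_mul, Nat.sub_mul, mul_comm s N]
        have := Nat.mul_le_mul_left t h
        omega
      calc (s - t) * s.descFactorial t * (N ^ t * N) = (s.descFactorial t * N ^ t) * ((s - t) * N) := by ring
        _ ≤ (N.descFactorial t * s ^ t) * ((N - t) * s) := Nat.mul_le_mul ih h2
        _ = _ := by ring
  rw [Nat.descFactorial_eq_factorial_mul_choose, Nat.descFactorial_eq_factorial_mul_choose] at h1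
  have := Nat.factorial_pos t
  refine Nat.le_of_mul_le_mul_left ?_ this
  calc _ = t.factorial * s.choose t * N ^ t := by ring
    _ ≤ _ := h1
    _ = _ := by ring

theorem count_supersets {Ω : Type*} [Fintype Ω] [DecidableEq Ω] (A : Finset Ω) (s : ℕ) (h : A.card ≤ s) :
    ((Finset.univ.powersetCard s).filter (fun S : Finset Ω => A ⊆ S)).card ≤
      (Fintype.card Ω - A.card).choose (s - A.card) := by
  rw [← Finset.card_compl, ← Finset.card_powersetCard]
  refine Finset.card_le_card_of_injOn (fun S => S \ A) ?_ ?_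
  · intro S hS
    simp only [Finset.coe_filter, Finset.mem_powersetCard, Set.mem_setOf_eq] at hS
    simp only [Finset.mem_coe, Finset.mem_powersetCard]
    refine ⟨?_, ?_⟩
    · intro x hx
      rw [Finset.mem_compl]
      exact (Finset.mem_sdiff.1 hx).2
    · rw [Finset.card_sdiff_of_subset hS.2, hS.1.2]
  · intro S hS T hT hST
    simp only [Finset.coe_filter, Finset.mem_powersetCard, Set.mem_setOf_eq] at hS hT
    have hST : S \ A = T \ A := hST
    rw [← Finset.sdiff_union_of_subset hS.2, hST, Finset.sdiff_union_of_subset hT.2]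

theorem count_big {Ω : Type*} [Fintype Ω] [DecidableEq Ω] (Y : Finset Ω) (s t : ℕ) (hs : s ≤ Fintype.card Ω) :
    ((Finset.univ.powersetCard s).filter (fun S : Finset Ω => t ≤ (S ∩ Y).card)).card * Fintype.card Ω ^ t ≤
      (Y.card * s) ^ t * (Fintype.card Ω).choose s := by
  set N := Fintype.card Ω
  by_cases ht : t ≤ s
  · have h1 : ((Finset.univ.powersetCard s).filter (fun S : Finset Ω => t ≤ (S ∩ Y).card)).card ≤
        Y.card.choose t * (N - t).choose (s - t) := by
      have hsub : (Finset.univ.powersetCard s).filter (fun S : Finset Ω => t ≤ (S ∩ Y).card) ⊆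
          (Y.powersetCard t).biUnion fun A => (Finset.univ.powersetCard s).filter (fun S : Finset Ω => A ⊆ S) := by
        intro S hS
        rw [Finset.mem_filter] at hS
        obtain ⟨A, hA, hA2⟩ := Finset.exists_subset_card_eq hS.2
        rw [Finset.mem_biUnion]
        refine ⟨A, Finset.mem_powersetCard.2 ⟨hA.trans Finset.inter_subset_right, hA2⟩, ?_⟩
        rw [Finset.mem_filter]
        exact ⟨hS.1, hA.trans Finset.inter_subset_left⟩
      refine (Finset.card_le_card hsub).trans ?_
      refine (Finset.card_biUnion_le_card_mul _ _ ((N - t).choose (s - t)) ?_).trans ?_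
      · intro A hA
        rw [Finset.mem_powersetCard] at hA
        have := count_supersets A s (by rw [hA.2]; exact ht)
        rwa [hA.2] at this
      · rw [Finset.card_powersetCard]
    have h2 : N.choose s * s.choose t = N.choose t * (N - t).choose (s - t) := Nat.choose_mul ht
    have h3 : 0 < N.choose t := Nat.choose_pos (ht.trans hs)
    have h4 := choose_pow s N t hs
    have h5 : Y.card.choose t ≤ Y.card ^ t := Nat.choose_le_pow _ _
    refine (Nat.mul_le_mul_right _ h1).trans ?_
    refine Nat.le_of_mul_le_mul_left ?_ h3
    calc N.choose t * (Y.card.choose t * (N - t).choose (s - t) * N ^ t)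
        = Y.card.choose t * (N.choose t * (N - t).choose (s - t)) * N ^ t := by ring
      _ = Y.card.choose t * N.choose s * (s.choose t * N ^ t) := by rw [← h2]; ring
      _ ≤ Y.card ^ t * N.choose s * (N.choose t * s ^ t) := by gcongr
      _ = _ := by rw [mul_pow]; ring
  · have : (Finset.univ.powersetCard s).filter (fun S : Finset Ω => t ≤ (S ∩ Y).card) = ∅ := by
      rw [Finset.filter_eq_empty_iff]
      intro S hS h
      rw [Finset.mem_powersetCard] at hS
      have := Finset.card_le_card (Finset.inter_subset_left (s₁ := S) (s₂ := Y))
      omega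
    rw [this]
    simp
end comb

section alg
variable {K : Type} [Field K] {n : ℕ} {ι : Type} [Fintype ι]
  (P : ι → Ideal (MvPolynomial (Fin n) K)) (r ρ : ι → ℕ) (q d k : ℕ)
  (hcore : ∀ i, Core (P i) q (r i) (ρ i)) (hr : ∀ i, r i ≤ k) (hρ : ∑ i, ρ i ≤ d)

include hcore hr hρ

theorem small_basis (Y : Finset (Fin n → K)) (hY : ∀ w ∈ Y, ∃ i, ∀ h ∈ P i, eval w h = 0) :
    ∃ B ⊆ Y, B.card ≤ d * (d + k).choose k ∧ ∀ f : MvPolynomial (Fin n) K, f.totalDegree ≤ d →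
      (∀ x ∈ B, eval x f = 0) → ∀ x ∈ Y, eval x f = 0 := by
  classical
  choose Λ hΛ using fun i => (hcore i).2.2.2.1 d
  let M := restrictTotalDegree (Fin n) K d
  let Φ : M →ₗ[K] ((i : ι) → Fin (ρ i * (d + r i).choose (r i)) → K) :=
    (LinearMap.pi Λ).comp M.subtype
  let ev : (Fin n → K) → Module.Dual K M := fun x => (aeval x : MvPolynomial (Fin n) K →ₐ[K] K).toLinearMap.comp M.subtype
  have hev : ∀ x (f : M), ev x f = eval x f.1 := fun x f => by
    simp [ev, MvPolynomial.coe_aeval_eq_eval]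
  have hmem : ∀ x ∈ Y, ev x ∈ LinearMap.range Φ.dualMap := by
    intro x hx
    rw [LinearMap.range_dualMap_eq_dualAnnihilator_ker, Submodule.mem_dualAnnihilator]
    intro f hf
    rw [hev]
    obtain ⟨i, hi⟩ := hY x hx
    apply hi
    apply hΛ i _ ((mem_restrictTotalDegree _ _ _).1 f.2)
    exact congrFun (LinearMap.mem_ker.1 hf) i
  have hdimle : Module.finrank K (LinearMap.range Φ.dualMap) ≤ d * (d + k).choose k := by
    refine (LinearMap.finrank_range_le _).trans ?_
    rw [Subspace.dual_finrank_eq, Module.finrank_pi_fintype]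
    simp only [Module.finrank_fin_fun]
    refine le_trans ?_ (Nat.mul_le_mul_right _ hρ)
    rw [Finset.sum_mul]
    refine Finset.sum_le_sum fun i _ => Nat.mul_le_mul_left _ ?_
    rw [Nat.choose_symm_add.symm, Nat.choose_symm_add.symm]
    exact Nat.choose_le_choose _ (Nat.add_le_add_left (hr i) _)
  obtain ⟨b, hbY, hbspan, hbind⟩ := exists_linearIndependent K (ev '' (Y : Set (Fin n → K)))
  have hbfin : b.Finite := (Y.finite_toSet.image ev).subset hbY
  -- choose representatives
  have hrep : ∀ φ ∈ b, ∃ x ∈ Y, ev x = φ := fun φ hφ => by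
    obtain ⟨x, hx, h⟩ := hbY hφ
    exact ⟨x, hx, h⟩
  choose! g hg1 hg2 using hrep
  refine ⟨hbfin.toFinset.image g, ?_, ?_, ?_⟩
  · intro x hx
    simp only [Finset.mem_image, Set.Finite.mem_toFinset] at hx
    obtain ⟨φ, hφ, rfl⟩ := hx
    exact hg1 φ hφ
  · refine Finset.card_image_le.trans (le_trans ?_ hdimle)
    haveI : Fintype b := hbfin.fintype
    have hb' : LinearIndependent K (fun φ : b => (⟨φ.1, by
      obtain ⟨x, hx, h⟩ := hbY φ.2
      rw [← h]
      exact hmem x hx⟩ : LinearMap.range Φ.dualMap)) := by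
      apply LinearIndependent.of_comp (LinearMap.range Φ.dualMap).subtype
      exact hbind
    have := hb'.fintype_card_le_finrank
    rwa [← Nat.card_eq_fintype_card, Nat.card_coe_set_eq, Set.ncard_eq_toFinset_card _ hbfin] at this
  · intro f hf h x hx
    let f' : M := ⟨f, (mem_restrictTotalDegree _ _ _).2 hf⟩
    have h1 : ev x ∈ Submodule.span K b := by
      rw [hbspan]
      exact Submodule.subset_span ⟨x, hx, rfl⟩
    have h2 : Submodule.span K b ≤ LinearMap.ker (LinearMap.applyₗ (R := K) f' : (M →ₗ[K] K) →ₗ[K] K) := by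
      rw [Submodule.span_le]
      intro φ hφ
      change φ f' = 0
      rw [← hg2 φ hφ, hev]
      exact h _ (Finset.mem_image_of_mem _ (hbfin.mem_toFinset.2 hφ))
    have h3 : ev x f' = 0 := h2 h1
    rwa [hev] at h3

theorem separate (x : Fin n → K) (hx : ¬ ∃ i, ∀ h ∈ P i, eval x h = 0) :
    ∃ G : MvPolynomial (Fin n) K, G.totalDegree ≤ d ∧ eval x G ≠ 0 ∧
      ∀ w, (∃ i, ∀ h ∈ P i, eval w h = 0) → eval w G = 0 := by
  push Not at hx
  choose G h1 h2 h3 using fun i => (hcore i).2.2.2.2.1 x (by push Not; exact hx i)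
  refine ⟨∏ i, G i, ?_, ?_, ?_⟩
  · exact (totalDegree_finset_prod _ _).trans ((Finset.sum_le_sum fun i _ => h2 i).trans hρ)
  · rw [map_prod]
    exact Finset.prod_ne_zero_iff.2 fun i _ => h3 i
  · rintro w ⟨i, hi⟩
    rw [map_prod]
    exact Finset.prod_eq_zero (Finset.mem_univ i) (hi _ (h1 i))

theorem points_le (hq : 1 ≤ q) (Y : Finset (Fin n → K))
    (hY : ∀ w ∈ Y, (∃ i, ∀ h ∈ P i, eval w h = 0) ∧ ∀ j, w j ^ q = w j) : Y.card ≤ d * q ^ k := by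
  classical
  have hsub : Y ⊆ Finset.univ.biUnion fun i => Y.filter fun w => ∀ h ∈ P i, eval w h = 0 := by
    intro w hw
    obtain ⟨i, hi⟩ := (hY w hw).1
    simp only [Finset.mem_biUnion, Finset.mem_filter, Finset.mem_univ, true_and]
    exact ⟨i, hw, hi⟩
  refine (Finset.card_le_card hsub).trans (Finset.card_biUnion_le.trans ?_)
  refine le_trans ?_ (Nat.mul_le_mul_right _ hρ)
  rw [Finset.sum_mul]
  refine Finset.sum_le_sum fun i _ => ?_
  refine ((hcore i).2.2.2.2.2 _ ?_).trans (Nat.mul_le_mul_left _ (Nat.pow_le_pow_right hq (hr i)))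
  intro w hw
  rw [Finset.mem_filter] at hw
  exact ⟨hw.2, (hY w hw.1).2⟩
end alg
end RSV


namespace RSV
set_option linter.all false
set_option linter.unusedSectionVars false
set_option linter.unusedSimpArgs false
set_option linter.style.haveILetI false

section final
variable (F K : Type) [Field F] [Fintype F] [Field K] [IsAlgClosed K] [Algebra F K]

/-- Embedding of `F`-points. -/
noncomputable def emb (n : ℕ) (x : Fin n → F) : Fin n → K := fun j => algebraMap F K (x j)

theorem emb_inj (n : ℕ) : Function.Injective (emb F K n) := by
  intro x y h
  funext j
  exact (algebraMap F K).injective (congrFun h j)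

open Classical in
/-- Closure of a tuple of points with respect to polynomials of degree at most `d`. -/
noncomputable def cl (n d m : ℕ) (g : Fin m → Fin n → F) : Finset (Fin n → F) :=
  Finset.univ.filter fun x => ∀ f : MvPolynomial (Fin n) K, f.totalDegree ≤ d →
    (∀ i, eval (emb F K n (g i)) f = 0) → eval (emb F K n x) f = 0

theorem exists_tuple (n d k : ℕ) (hd : 1 ≤ d) (hdk : d ≤ Fintype.card F ^ k) (V : Set (Fin n → K))
    (hV : IsAffineVariety K n V) (hdeg : vdeg K n V = (d : ℕ∞))
    (hdim : vdim K n V = (k : WithBot ℕ∞)) (S : Finset (Fin n → F))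
    (hS : ∃ x ∈ S, emb F K n x ∈ V) :
    ∃ g : Fin (d * (d + k).choose k) → Fin n → F, (cl F K n d _ g).card ≤ Fintype.card F ^ (2 * k) ∧
      ∀ x ∈ S, emb F K n x ∈ V → x ∈ cl F K n d _ g := by
  classical
  obtain ⟨p, hp⟩ := CharP.exists F
  haveI := hp
  haveI : Fact p.Prime := ⟨CharP.char_is_prime F p⟩
  haveI : CharP K p := charP_of_injective_algebraMap (algebraMap F K).injective p
  have hq : 2 ≤ Fintype.card F := Fintype.one_lt_card
  obtain ⟨ι, hι, P, r, ρ, hcore, hr, hρ, hmem⟩ := components p (Fintype.card F) hq V hV d k hd hdeg hdim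
  obtain ⟨B, hBY, hBc, hB⟩ := small_basis P r ρ _ d k hcore hr hρ
    ((S.filter fun x => emb F K n x ∈ V).image (emb F K n)) (by
      intro w hw
      simp only [Finset.mem_image, Finset.mem_filter] at hw
      obtain ⟨x, ⟨-, hx⟩, rfl⟩ := hw
      exact (hmem _).1 hx)
  have hBne : B.Nonempty := by
    rw [Finset.nonempty_iff_ne_empty]
    rintro rfl
    obtain ⟨x, hx, hxV⟩ := hS
    have := hB 1 (by simp) (by simp) (emb F K n x)
      (Finset.mem_image_of_mem _ (Finset.mem_filter.2 ⟨hx, hxV⟩))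
    simp at this
  have hBV : ∀ w ∈ B, w ∈ V ∧ ∃ x, emb F K n x = w := by
    intro w hw
    have := hBY hw
    simp only [Finset.mem_image, Finset.mem_filter] at this
    obtain ⟨x, ⟨-, hx⟩, rfl⟩ := this
    exact ⟨hx, x, rfl⟩
  haveI : Nonempty B := hBne.to_subtype
  have hemb : Nonempty (B ↪ Fin (d * (d + k).choose k)) := by
    rw [Function.Embedding.nonempty_iff_card_le]
    simpa using hBc
  obtain ⟨e⟩ := hemb
  choose u hu using fun w : B => (hBV w.1 w.2).2
  let g : Fin (d * (d + k).choose k) → Fin n → F := fun i => u (Function.invFun e i)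
  have hg : ∀ i, emb F K n (g i) ∈ B := fun i => by
    simp only [g, hu]
    exact (Function.invFun e i).2
  have hg2 : ∀ w ∈ B, ∃ i, emb F K n (g i) = w := fun w hw => by
    refine ⟨e ⟨w, hw⟩, ?_⟩
    simp only [g, hu]
    rw [Function.leftInverse_invFun e.injective]
  refine ⟨g, ?_, ?_⟩
  · have hclV : ∀ x ∈ cl F K n d _ g, emb F K n x ∈ V := by
      intro x hx
      rw [cl, Finset.mem_filter] at hx
      by_contra h
      rw [hmem] at h
      obtain ⟨G, h1, h2, h3⟩ := separate P r ρ _ d k hcore hr hρ _ h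
      apply h2
      apply hx.2 G h1
      intro i
      apply h3
      rw [← hmem]
      exact (hBV _ (hg i)).1
    have h1 := points_le P r ρ (Fintype.card F) d k hcore hr hρ (by omega)
      ((cl F K n d _ g).image (emb F K n)) (by
        intro w hw
        rw [Finset.mem_image] at hw
        obtain ⟨x, hx, rfl⟩ := hw
        refine ⟨(hmem _).1 (hclV x hx), fun j => ?_⟩
        rw [emb, ← map_pow, FiniteField.pow_card])
    rw [Finset.card_image_of_injective _ (emb_inj F K n)] at h1
    refine h1.trans ?_
    rw [two_mul, pow_add]
    exact Nat.mul_le_mul_right _ hdk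
  · intro x hx hxV
    rw [cl, Finset.mem_filter]
    refine ⟨Finset.mem_univ _, fun f hf h => ?_⟩
    refine hB f hf ?_ _ (Finset.mem_image_of_mem _ (Finset.mem_filter.2 ⟨hx, hxV⟩))
    intro w hw
    obtain ⟨i, rfl⟩ := hg2 w hw
    exact h i

theorem key_ineq (q n d k s t m : ℕ) (ε : ℝ) (hq : 2 ≤ q) (hε : 0 < ε) (hk : (k : ℝ) ≤ ε * n / 4)
    (hs : (s : ℝ) = (q : ℝ) ^ ((1 - ε) * n)) (ht : 4 * (m : ℝ) / ε ≤ t) :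
    (q ^ (2 * k) * s) ^ t * q ^ (2 * n * m) ≤ (q ^ n) ^ t := by
  have hq0 : (0 : ℝ) < q := by positivity
  have hq1 : (1 : ℝ) ≤ q := by exact_mod_cast (by omega : 1 ≤ q)
  have h : (((q ^ (2 * k) * s) ^ t * q ^ (2 * n * m) : ℕ) : ℝ) ≤ (((q ^ n) ^ t : ℕ) : ℝ) := by
    push_cast
    rw [hs, ← Real.rpow_natCast (q : ℝ) (2 * k), ← Real.rpow_add hq0, ← Real.rpow_natCast _ t,
      ← Real.rpow_mul hq0.le, ← Real.rpow_natCast (q : ℝ) (2 * n * m), ← Real.rpow_add hq0,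
      ← Real.rpow_natCast (q : ℝ) n, ← Real.rpow_natCast _ t, ← Real.rpow_mul hq0.le]
    apply Real.rpow_le_rpow_of_exponent_le hq1
    push_cast
    rw [div_le_iff₀ hε] at ht
    have hn : (0 : ℝ) ≤ n := Nat.cast_nonneg n
    have h1 := mul_le_mul_of_nonneg_left ht hn
    have h2 := mul_le_mul_of_nonneg_right hk (Nat.cast_nonneg (α := ℝ) t)
    nlinarith
  exact_mod_cast h
end final
end RSV

theorem random_subset_variety_evasive :
    ∃ C : ℕ, 0 < C ∧
      ∀ (F K : Type) [Field F] [Fintype F] [Field K] [IsAlgClosed K] [Algebra F K]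
        [Algebra.IsAlgebraic F K],
        ∀ n d k : ℕ, ∀ ε : ℝ, ∀ s : ℕ,
          1 ≤ n → 1 ≤ d → 1 ≤ k → 0 < ε → (k : ℝ) ≤ ε * n / 4 →
          d ≤ Fintype.card F ^ k →
          (s : ℝ) = (Fintype.card F : ℝ) ^ ((1 - ε) * n) →
          2 * {S : Finset (Fin n → F) | S.card = s ∧
              ¬ ∀ V : Set (Fin n → K), IsAffineVariety K n V → DefinedOver F K n V →
                  vdeg K n V = (d : ℕ∞) → vdim K n V = (k : WithBot ℕ∞) →
                  (((↑S : Set (Fin n → F)) ∩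
                      {x : Fin n → F | (fun j => algebraMap F K (x j)) ∈ V}).ncard : ℝ) ≤
                    C * ((d : ℝ) / ε) * (Nat.choose (k + d + 2) k : ℝ)}.ncard ≤
            {S : Finset (Fin n → F) | S.card = s}.ncard := by
  classical
  refine ⟨4, by norm_num, ?_⟩
  intro F K _ _ _ _ _ _ n d k ε s hn hd hk hε hkε hdk hs
  set q := Fintype.card F with hqdef
  have hq : 2 ≤ q := Fintype.one_lt_card
  set m := d * (d + k).choose k with hm
  have hm1 : 1 ≤ m := Nat.mul_pos hd (Nat.choose_pos (by omega))
  set t := ⌈(4 : ℕ) * ((d : ℝ) / ε) * (Nat.choose (k + d + 2) k : ℝ)⌉₊ with ht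
  have htm : 4 * (m : ℝ) / ε ≤ t := by
    refine le_trans ?_ (Nat.le_ceil _)
    have h1 : ((d + k).choose k : ℝ) ≤ (k + d + 2).choose k := by
      exact_mod_cast Nat.choose_le_choose _ (by omega)
    have h2 : 0 ≤ 4 * ((d : ℝ) / ε) := by positivity
    calc 4 * (m : ℝ) / ε = 4 * ((d : ℝ) / ε) * ((d + k).choose k : ℝ) := by
          rw [hm]; push_cast; ring
      _ ≤ 4 * ((d : ℝ) / ε) * (k + d + 2).choose k := mul_le_mul_of_nonneg_left h1 h2
      _ = _ := by push_cast; ring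
  have hN : Fintype.card (Fin n → F) = q ^ n := by simp [hqdef]
  have hsN : s ≤ Fintype.card (Fin n → F) := by
    rw [hN]
    have : (s : ℝ) ≤ ((q ^ n : ℕ) : ℝ) := by
      rw [hs]
      push_cast
      rw [← Real.rpow_natCast]
      apply Real.rpow_le_rpow_of_exponent_le (by exact_mod_cast (by omega : 1 ≤ q))
      have : (0 : ℝ) ≤ ε * n := by positivity
      linarith
    exact_mod_cast this
  have hall : {S : Finset (Fin n → F) | S.card = s} = ((Finset.univ.powersetCard s : Finset (Finset (Fin n → F))) : Set _) := by
    ext S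
    simp [Finset.mem_powersetCard]
  rw [hall, Set.ncard_coe_finset, Finset.card_powersetCard, Finset.card_univ]
  set bad := {S : Finset (Fin n → F) | S.card = s ∧
              ¬ ∀ V : Set (Fin n → K), IsAffineVariety K n V → DefinedOver F K n V →
                  vdeg K n V = (d : ℕ∞) → vdim K n V = (k : WithBot ℕ∞) →
                  (((↑S : Set (Fin n → F)) ∩
                      {x : Fin n → F | (fun j => algebraMap F K (x j)) ∈ V}).ncard : ℝ) ≤
                    (4 : ℕ) * ((d : ℝ) / ε) * (Nat.choose (k + d + 2) k : ℝ)} with hbad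
  let G : Finset (Fin m → Fin n → F) := Finset.univ.filter fun g => (RSV.cl F K n d m g).card ≤ q ^ (2 * k)
  let U : Finset (Finset (Fin n → F)) := G.biUnion fun g =>
    (Finset.univ.powersetCard s).filter (fun S : Finset (Fin n → F) => t ≤ (S ∩ RSV.cl F K n d m g).card)
  have hsub : bad ⊆ (U : Set (Finset (Fin n → F))) := by
    rintro S ⟨hSs, hS⟩
    push Not at hS
    obtain ⟨V, hV, -, hdeg, hdim, hgt⟩ := hS
    have hnonneg : (0 : ℝ) ≤ (4 : ℕ) * ((d : ℝ) / ε) * (Nat.choose (k + d + 2) k : ℝ) := by positivity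
    have hpos : 0 < ((↑S : Set (Fin n → F)) ∩ {x : Fin n → F | (fun j => algebraMap F K (x j)) ∈ V}).ncard := by
      have := lt_of_le_of_lt hnonneg hgt
      exact_mod_cast this
    obtain ⟨x, hx, hxV⟩ := Set.nonempty_of_ncard_ne_zero hpos.ne'
    obtain ⟨g, hg1, hg2⟩ := RSV.exists_tuple F K n d k hd hdk V hV hdeg hdim S ⟨x, hx, hxV⟩
    simp only [U, Finset.coe_biUnion, Set.mem_iUnion]
    refine ⟨g, Finset.mem_coe.2 (Finset.mem_filter.2 ⟨Finset.mem_univ _, hg1⟩), ?_⟩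
    rw [Finset.mem_coe, Finset.mem_filter, Finset.mem_powersetCard]
    refine ⟨⟨Finset.subset_univ _, hSs⟩, ?_⟩
    rw [ht, Nat.ceil_le]
    refine hgt.le.trans ?_
    refine Nat.cast_le.2 ?_
    rw [← Set.ncard_coe_finset]
    apply Set.ncard_le_ncard _ (Finset.finite_toSet _)
    rintro y ⟨hy1, hy2⟩
    exact Finset.mem_coe.2 (Finset.mem_inter.2 ⟨hy1, hg2 y hy1 hy2⟩)
  have hbU : bad.ncard ≤ U.card := by
    rw [← Set.ncard_coe_finset]
    exact Set.ncard_le_ncard hsub (Finset.finite_toSet _)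
  have hkey := RSV.key_ineq q n d k s t m ε hq hε hkε hs htm
  have hU : U.card * (q ^ n) ^ t ≤ q ^ (n * m) * ((q ^ (2 * k) * s) ^ t * (q ^ n).choose s) := by
    have h1 : U.card ≤ ∑ g ∈ G, ((Finset.univ.powersetCard s).filter
      (fun S : Finset (Fin n → F) => t ≤ (S ∩ RSV.cl F K n d m g).card)).card := Finset.card_biUnion_le
    refine (Nat.mul_le_mul_right _ h1).trans ?_
    rw [Finset.sum_mul]
    have h2 : ∀ g ∈ G, ((Finset.univ.powersetCard s).filter
      (fun S : Finset (Fin n → F) => t ≤ (S ∩ RSV.cl F K n d m g).card)).card * (q ^ n) ^ t ≤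
        (q ^ (2 * k) * s) ^ t * (q ^ n).choose s := by
      intro g hg
      have h3 := RSV.count_big (RSV.cl F K n d m g) s t hsN
      rw [hN] at h3
      refine h3.trans (Nat.mul_le_mul_right _ (Nat.pow_le_pow_left (Nat.mul_le_mul_right _ ?_) _))
      exact (Finset.mem_filter.1 hg).2
    refine (Finset.sum_le_card_nsmul _ _ _ h2).trans ?_
    rw [smul_eq_mul]
    refine Nat.mul_le_mul_right _ ?_
    refine (Finset.card_le_univ _).trans ?_
    simp [hqdef, ← pow_mul]
  rw [hN]
  have hA : 0 < (q ^ n) ^ t := by positivity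
  have hB : 0 < q ^ (n * m) := by positivity
  have h1 : U.card * q ^ (n * m) ≤ (q ^ n).choose s := by
    have h2 : (U.card * q ^ (n * m)) * ((q ^ n) ^ t * q ^ (n * m)) ≤
        (q ^ n).choose s * ((q ^ n) ^ t * q ^ (n * m)) := by
      calc (U.card * q ^ (n * m)) * ((q ^ n) ^ t * q ^ (n * m))
          = (U.card * (q ^ n) ^ t) * q ^ (2 * n * m) := by
            rw [mul_assoc 2 n m, two_mul, pow_add]; ring
        _ ≤ (q ^ (n * m) * ((q ^ (2 * k) * s) ^ t * (q ^ n).choose s)) * q ^ (2 * n * m) :=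
            Nat.mul_le_mul_right _ hU
        _ = q ^ (n * m) * (q ^ n).choose s * ((q ^ (2 * k) * s) ^ t * q ^ (2 * n * m)) := by ring
        _ ≤ q ^ (n * m) * (q ^ n).choose s * (q ^ n) ^ t := Nat.mul_le_mul_left _ hkey
        _ = _ := by ring
    exact Nat.le_of_mul_le_mul_right h2 (Nat.mul_pos hA hB)
  have h3 : 2 ≤ q ^ (n * m) := hq.trans (Nat.le_self_pow (Nat.mul_pos hn hm1).ne' q)
  calc 2 * bad.ncard ≤ q ^ (n * m) * U.card := Nat.mul_le_mul h3 hbU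
    _ = U.card * q ^ (n * m) := mul_comm _ _
    _ ≤ _ := h1
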